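/- arXiv:math-ph/0510091 — 4 statements merged into one kernel-verified Lean document; each statement's English description precedes it below -/
import Mathlib

section
/- Let Γ > 0 and μ > 0. For every closed curve γ₀ : [0,1] → ℝ³ with γ₀(0) = γ₀(1) that is absolutely continuous with derivative γ₀' ∈ L²((0,1); ℝ³), there exist T* > 0 and a unique function γ : [0,T*) × [0,1] → ℝ³ such that: (i) for every t ∈ [0,T*), γ(t,·) is a closed absolutely continuous curve whose derivative ∂_ξγ(t,·) lies in L²((0,1); ℝ³), with sup_{t ≤ T'} ‖∂_ξγ(t,·)‖_{L²} < ∞ for every T' < T*; (ii) t ↦ γ(t,·) is Lipschitz from every compact subinterval of [0,T*) into L²((0,1); ℝ³); (iii) for all t ∈ [0,T*) and a.e. ξ ∈ [0,1], γ(t,ξ) = γ₀(ξ) − (Γ/(4π)) ∫₀ᵗ ∫₀¹ [(γ(τ,ξ) − γ(τ,η)) / (|γ(τ,ξ) − γ(τ,η)|² + μ²)^{3/2}] ∧ ∂_ηγ(τ,η) dη dτ. Moreover T* admits a strictly positive lower bound depending only on ‖γ₀‖_{L²} + ‖γ₀'‖_{L²}. -/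
noncomputable section
open MeasureTheory Real Set

/-- Three-dimensional Euclidean space. -/
abbrev E3 := EuclideanSpace ℝ (Fin 3)

/-- The cross product on `ℝ³`. -/
def cross3 (a b : E3) : E3 := WithLp.toLp 2 (crossProduct a b)

/-- `γ : [0,1] → ℝ³` is a closed curve, absolutely continuous with derivative `γd`
belonging to `L²((0,1); ℝ³)`. -/
structure IsH1Loop (γ γd : ℝ → E3) : Prop where
  closed : γ 0 = γ 1
  deriv_eq : ∀ ξ ∈ Icc (0:ℝ) 1, γ ξ = γ 0 + ∫ s in (0:ℝ)..ξ, γd s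
  memL2 : MemLp γd 2 (volume.restrict (Ioc (0:ℝ) 1))

/-- `γ` is a strong solution on `[0, Tstar)` of the Rosenhead regularized vortex
filament equation with circulation `Γ`, regularization `μ` and initial datum `γ₀`:
(i) for each `t`, `γ(t,·)` is a closed `H¹` curve with derivative `γd(t,·)`,
the `L²` norms of the derivatives being bounded on compact subintervals of `[0,Tstar)`;
(ii) `t ↦ γ(t,·)` is Lipschitz from compact subintervals of `[0,Tstar)` into `L²(0,1)`;
(iii) the integral form of the Rosenhead equation holds for a.e. `ξ ∈ [0,1]`. -/
def IsRosenheadSolution (Γ μ : ℝ) (γ₀ : ℝ → E3) (Tstar : ℝ) (γ : ℝ → ℝ → E3) : Prop :=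
  ∃ γd : ℝ → ℝ → E3,
    (∀ t ∈ Ico (0:ℝ) Tstar, IsH1Loop (γ t) (γd t)) ∧
    (∀ T' ∈ Ico (0:ℝ) Tstar, ∃ M : ℝ, ∀ t ∈ Icc (0:ℝ) T',
      (∫ ξ in Ioc (0:ℝ) 1, ‖γd t ξ‖ ^ 2) ≤ M) ∧
    (∀ T' ∈ Ico (0:ℝ) Tstar, ∃ K : ℝ, ∀ s ∈ Icc (0:ℝ) T', ∀ t ∈ Icc (0:ℝ) T',
      Real.sqrt (∫ ξ in Ioc (0:ℝ) 1, ‖γ t ξ - γ s ξ‖ ^ 2) ≤ K * |t - s|) ∧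
    (∀ t ∈ Ico (0:ℝ) Tstar, ∀ᵐ ξ ∂(volume.restrict (Ioc (0:ℝ) 1)),
      γ t ξ = γ₀ ξ - (Γ / (4 * π)) •
        ∫ τ in (0:ℝ)..t, ∫ η in (0:ℝ)..1,
          ((‖γ τ ξ - γ τ η‖ ^ 2 + μ ^ 2) ^ (-(3:ℝ) / 2)) •
            cross3 (γ τ ξ - γ τ η) (γd τ η))


/-- A map whose increments are dominated by those of an absolutely continuous map is absolutely
continuous. -/
theorem AbsolutelyContinuousOnInterval.of_dist_le {X Y : Type*} [PseudoMetricSpace X]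
    [PseudoMetricSpace Y] {f : ℝ → X} {g : ℝ → Y} {a b C : ℝ}
    (hg : AbsolutelyContinuousOnInterval g a b)
    (h : ∀ x ∈ uIcc a b, ∀ y ∈ uIcc a b, dist (f x) (f y) ≤ C * dist (g x) (g y)) :
    AbsolutelyContinuousOnInterval f a b := by
  have h0 := Filter.Tendsto.const_mul C hg
  rw [mul_zero] at h0
  refine squeeze_zero' (Filter.Eventually.of_forall fun E => Finset.sum_nonneg fun i _ => dist_nonneg)
    ?_ h0
  rw [Filter.eventually_inf_principal]
  refine Filter.Eventually.of_forall fun E hE => ?_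
  rw [Finset.mul_sum]
  refine Finset.sum_le_sum fun i hi => ?_
  have := hE.1 i hi
  exact h _ this.1 _ this.2

/-- Chain rule for the composition of a `C¹` map with a primitive. -/
theorem comp_primitive_eq {E F : Type*} [NormedAddCommGroup E] [NormedSpace ℝ E] [ProperSpace E]
    [NormedAddCommGroup F] [NormedSpace ℝ F] [CompleteSpace F] {Φ : E → F} (hΦ : ContDiff ℝ 1 Φ)
    {u : ℝ → E} (hu : IntervalIntegrable u volume 0 1) (a : E) {x : ℝ} (hx : x ∈ Icc (0:ℝ) 1) :
    Φ (a + ∫ s in (0:ℝ)..x, u s) =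
      Φ a + ∫ s in (0:ℝ)..x, fderiv ℝ Φ (a + ∫ r in (0:ℝ)..s, u r) (u s) := by
  set U : ℝ → E := fun x => a + ∫ s in (0:ℝ)..x, u s with hU
  have hUsub : ∀ x ∈ Icc (0:ℝ) 1, ∀ y ∈ Icc (0:ℝ) 1, IntervalIntegrable u volume x y := by
    intro x hx y hy
    exact hu.mono_set (by rw [uIcc_of_le zero_le_one]; exact uIcc_subset_Icc hx hy)
  have h0 : (0:ℝ) ∈ Icc (0:ℝ) 1 := by simp
  have hUc : ContinuousOn U (Icc 0 1) := by
    have := intervalIntegral.continuousOn_primitive_interval' hu (a := 0) (by simp)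
    rw [uIcc_of_le zero_le_one] at this
    exact continuousOn_const.add this
  have hdc : Continuous (fderiv ℝ Φ) := hΦ.continuous_fderiv (by simp)
  obtain ⟨R, hR⟩ := (isCompact_Icc.image_of_continuousOn hUc).isBounded.subset_closedBall 0
  obtain ⟨C, hC⟩ := (isCompact_closedBall (0:E) R).exists_bound_of_continuousOn hdc.continuousOn
  have hUmem : ∀ x ∈ Icc (0:ℝ) 1, U x ∈ Metric.closedBall (0:E) R := fun x hx =>
    hR (mem_image_of_mem _ hx)
  have hC0 : 0 ≤ C := (norm_nonneg _).trans (hC _ (hUmem 0 h0))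
  have hdu : IntervalIntegrable (fun s => fderiv ℝ Φ (U s) (u s)) volume 0 1 := by
    rw [intervalIntegrable_iff_integrableOn_Ioc_of_le zero_le_one] at hu ⊢
    refine Integrable.mono' (hu.norm.const_mul C) ?_ ?_
    · have h1 : AEStronglyMeasurable (fun s => fderiv ℝ Φ (U s)) (volume.restrict (Ioc 0 1)) :=
        (hdc.comp_continuousOn (hUc.mono Ioc_subset_Icc_self)).aestronglyMeasurable measurableSet_Ioc
      exact (ContinuousLinearMap.apply ℝ F).flip.aestronglyMeasurable_comp₂ h1 hu.1
    · refine (ae_restrict_iff' measurableSet_Ioc).2 (Filter.Eventually.of_forall fun s hs => ?_)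
      exact (ContinuousLinearMap.le_opNorm _ _).trans
        (mul_le_mul_of_nonneg_right (hC _ (hUmem s (Ioc_subset_Icc_self hs))) (norm_nonneg _))
  have hdusub : ∀ x ∈ Icc (0:ℝ) 1, ∀ y ∈ Icc (0:ℝ) 1,
      IntervalIntegrable (fun s => fderiv ℝ Φ (U s) (u s)) volume x y := by
    intro x hx y hy
    exact hdu.mono_set (by rw [uIcc_of_le zero_le_one]; exact uIcc_subset_Icc hx hy)
  set N : ℝ → ℝ := fun x => ∫ s in (0:ℝ)..x, ‖u s‖
  have hN : AbsolutelyContinuousOnInterval N 0 1 :=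
    hu.norm.absolutelyContinuousOnInterval_intervalIntegral (by simp)
  have hNd : ∀ x ∈ Icc (0:ℝ) 1, ∀ y ∈ Icc (0:ℝ) 1, |∫ s in x..y, ‖u s‖| = dist (N x) (N y) := by
    intro x hx y hy
    rw [dist_comm, Real.dist_eq, intervalIntegral.integral_interval_sub_left
      (hUsub _ h0 _ hy).norm (hUsub _ h0 _ hx).norm]
  have hac : AbsolutelyContinuousOnInterval
      (fun x => Φ (U x) - ∫ s in (0:ℝ)..x, fderiv ℝ Φ (U s) (u s)) 0 1 := by
    refine hN.of_dist_le (C := C + C) ?_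
    rw [uIcc_of_le zero_le_one]
    intro x hx y hy
    rw [dist_eq_norm, sub_sub_sub_comm, intervalIntegral.integral_interval_sub_left
      (hdusub _ h0 _ hx) (hdusub _ h0 _ hy), add_mul]
    refine (norm_sub_le _ _).trans (add_le_add ?_ ?_)
    · have h1 := (convex_closedBall (0:E) R).norm_image_sub_le_of_norm_fderiv_le (𝕜 := ℝ)
        (fun z _ => (hΦ.differentiable (by simp)) z) hC (hUmem y hy) (hUmem x hx)
      refine h1.trans (mul_le_mul_of_nonneg_left ?_ hC0)
      have : U x - U y = ∫ s in y..x, u s := by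
        simp only [hU, add_sub_add_left_eq_sub]
        exact intervalIntegral.integral_interval_sub_left (hUsub _ h0 _ hx) (hUsub _ h0 _ hy)
      rw [this, dist_comm, ← hNd y hy x hx]
      exact intervalIntegral.norm_integral_le_abs_integral_norm
    · rw [dist_comm, ← hNd y hy x hx]
      refine (intervalIntegral.norm_integral_le_abs_of_norm_le (g := fun s => C * ‖u s‖) ?_
        ((hUsub _ hy _ hx).norm.const_mul C)).trans_eq ?_
      · refine (ae_restrict_iff' measurableSet_uIoc).2 (Filter.Eventually.of_forall fun s hs => ?_)
        exact (ContinuousLinearMap.le_opNorm _ _).trans (mul_le_mul_of_nonneg_right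
          (hC _ (hUmem s (uIcc_subset_Icc hy hx (uIoc_subset_uIcc hs)))) (norm_nonneg _))
      · rw [intervalIntegral.integral_const_mul, abs_mul, abs_of_nonneg hC0]
  obtain ⟨c, hc⟩ := hac.const_of_ae_hasDerivAt_zero (by
    filter_upwards [hu.ae_hasDerivAt_integral, hdu.ae_hasDerivAt_integral] with x h1 h2 hx
    have h1' : HasDerivAt U (u x) x := (h1 hx 0 (by simp)).const_add a
    have h3 := (((hΦ.differentiable (by simp)) (U x)).hasFDerivAt.comp_hasDerivAt x h1').sub
      (h2 hx 0 (by simp))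
    rw [sub_self] at h3
    exact h3)
  rw [uIcc_of_le zero_le_one] at hc
  have e := (hc x hx).trans (hc 0 h0).symm
  simp only [intervalIntegral.integral_same, sub_zero] at e
  have e0 : U 0 = a := by simp [hU]
  rw [e0] at e
  exact sub_eq_iff_eq_add.1 e

/-- Lebesgue measure on the unit interval. -/
abbrev unitVol : Measure ℝ := volume.restrict (Ioc (0:ℝ) 1)

instance : IsProbabilityMeasure unitVol := ⟨by simp⟩

theorem intervalIntegrable_of_unitVol {E : Type*} [NormedAddCommGroup E] {g : ℝ → E}
    (hg : Integrable g unitVol) {x y : ℝ} (hx : x ∈ Icc (0:ℝ) 1) (hy : y ∈ Icc (0:ℝ) 1) :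
    IntervalIntegrable g volume x y :=
  ((intervalIntegrable_iff_integrableOn_Ioc_of_le zero_le_one).2 hg).mono_set
    (by rw [uIcc_of_le zero_le_one]; exact uIcc_subset_Icc hx hy)

theorem norm_intervalIntegral_le_unitVol {E : Type*} [NormedAddCommGroup E] [NormedSpace ℝ E]
    {g : ℝ → E} (hg : Integrable g unitVol) {x y : ℝ} (hx : x ∈ Icc (0:ℝ) 1)
    (hy : y ∈ Icc (0:ℝ) 1) : ‖∫ s in x..y, g s‖ ≤ ∫ s, ‖g s‖ ∂unitVol := by
  refine intervalIntegral.norm_integral_le_integral_norm_uIoc.trans ?_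
  refine setIntegral_mono_set hg.norm (Filter.Eventually.of_forall fun s => norm_nonneg _) ?_
  refine Filter.Eventually.of_forall fun s hs => ?_
  rcases hx with ⟨hx0, hx1⟩
  rcases hy with ⟨hy0, hy1⟩
  exact ⟨(le_min hx0 hy0).trans_lt hs.1, hs.2.trans (max_le hx1 hy1)⟩

section Bilinear

variable {E E' F : Type*} [NormedAddCommGroup E] [NormedSpace ℝ E] [NormedAddCommGroup E']
  [NormedSpace ℝ E'] [NormedAddCommGroup F] [NormedSpace ℝ F]

theorem integrable_bilin (B : E →L[ℝ] E' →L[ℝ] F) {H : ℝ → E} {g : ℝ → E'}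
    (hH : ContinuousOn H (Icc 0 1)) (hg : Integrable g unitVol) :
    Integrable (fun η => B (H η) (g η)) unitVol := by
  obtain ⟨C, hC⟩ := isCompact_Icc.exists_bound_of_continuousOn hH
  refine Integrable.mono' (hg.norm.const_mul (‖B‖ * C)) ?_ ?_
  · exact B.aestronglyMeasurable_comp₂
      ((hH.mono Ioc_subset_Icc_self).aestronglyMeasurable measurableSet_Ioc) hg.1
  · refine (ae_restrict_iff' measurableSet_Ioc).2 (Filter.Eventually.of_forall fun s hs => ?_)
    refine (B.le_opNorm₂ _ _).trans ?_
    gcongr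
    exact hC s (Ioc_subset_Icc_self hs)

theorem norm_integral_bilin_le (B : E →L[ℝ] E' →L[ℝ] F) {H : ℝ → E} {g : ℝ → E'} {c : ℝ}
    (hc : ∀ η ∈ Icc (0:ℝ) 1, ‖H η‖ ≤ c) (hg : Integrable g unitVol) :
    ‖∫ η, B (H η) (g η) ∂unitVol‖ ≤ ‖B‖ * c * ∫ η, ‖g η‖ ∂unitVol := by
  rw [← integral_const_mul]
  refine norm_integral_le_of_norm_le (hg.norm.const_mul _) ?_
  refine (ae_restrict_iff' measurableSet_Ioc).2 (Filter.Eventually.of_forall fun s hs => ?_)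
  refine (B.le_opNorm₂ _ _).trans ?_
  gcongr
  exact hc s (Ioc_subset_Icc_self hs)

theorem norm_integral_bilin_sub_le (B : E →L[ℝ] E' →L[ℝ] F) {H₁ H₂ : ℝ → E} {g₁ g₂ : ℝ → E'}
    {δ c M : ℝ} (hH₁ : ContinuousOn H₁ (Icc 0 1)) (hH₂ : ContinuousOn H₂ (Icc 0 1))
    (hg₁ : Integrable g₁ unitVol) (hg₂ : Integrable g₂ unitVol)
    (hδ : ∀ η ∈ Icc (0:ℝ) 1, ‖H₁ η - H₂ η‖ ≤ δ) (hc : ∀ η ∈ Icc (0:ℝ) 1, ‖H₂ η‖ ≤ c)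
    (hM : ∫ η, ‖g₁ η‖ ∂unitVol ≤ M) :
    ‖(∫ η, B (H₁ η) (g₁ η) ∂unitVol) - ∫ η, B (H₂ η) (g₂ η) ∂unitVol‖ ≤
      ‖B‖ * (δ * M + c * ∫ η, ‖g₁ η - g₂ η‖ ∂unitVol) := by
  have hδ0 : 0 ≤ δ := (norm_nonneg _).trans (hδ 0 (by simp))
  have e : (∫ η, B (H₁ η) (g₁ η) ∂unitVol) - ∫ η, B (H₂ η) (g₂ η) ∂unitVol =
      (∫ η, B (H₁ η - H₂ η) (g₁ η) ∂unitVol) + ∫ η, B (H₂ η) (g₁ η - g₂ η) ∂unitVol := by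
    have i₁ : Integrable (fun η => B (H₁ η - H₂ η) (g₁ η)) unitVol :=
      integrable_bilin B (hH₁.sub hH₂) hg₁
    have i₂ : Integrable (fun η => B (H₂ η) (g₁ η - g₂ η)) unitVol :=
      integrable_bilin B hH₂ (hg₁.sub hg₂)
    rw [← integral_sub (integrable_bilin B hH₁ hg₁) (integrable_bilin B hH₂ hg₂),
      ← integral_add i₁ i₂]
    congr with η
    simp
  rw [e]
  refine (norm_add_le _ _).trans ?_
  have h1 := norm_integral_bilin_le B hδ hg₁
  have h2 := norm_integral_bilin_le B hc (hg₁.sub hg₂)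
  have h3 : ‖B‖ * δ * ∫ η, ‖g₁ η‖ ∂unitVol ≤ ‖B‖ * δ * M :=
    mul_le_mul_of_nonneg_left hM (by positivity)
  simp only [Pi.sub_apply] at h2
  linarith

end Bilinear

section Kernel

variable {G : E3 → E3} {B : E3 →L[ℝ] E3 →L[ℝ] E3}

theorem exists_kernel_bound (hG : ContDiff ℝ 2 G) (R : ℝ) : ∃ C : ℝ, 0 ≤ C ∧
    (∀ z ∈ Metric.closedBall (0:E3) R, ‖G z‖ ≤ C ∧ ‖fderiv ℝ G z‖ ≤ C) ∧
    ∀ z ∈ Metric.closedBall (0:E3) R, ∀ w ∈ Metric.closedBall (0:E3) R,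
      ‖G z - G w‖ ≤ C * ‖z - w‖ ∧ ‖fderiv ℝ G z - fderiv ℝ G w‖ ≤ C * ‖z - w‖ := by
  have hG1 : ContDiff ℝ 1 (fderiv ℝ G) := hG.fderiv_right (by norm_num)
  have hK := isCompact_closedBall (0:E3) R
  obtain ⟨C₀, h₀⟩ := hK.exists_bound_of_continuousOn hG.continuous.continuousOn
  obtain ⟨C₁, h₁⟩ := hK.exists_bound_of_continuousOn hG1.continuous.continuousOn
  obtain ⟨C₂, h₂⟩ := hK.exists_bound_of_continuousOn
    (hG1.continuous_fderiv (by norm_num)).continuousOn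
  set C := max 0 (max C₀ (max C₁ C₂))
  have c0 : C₀ ≤ C := by simp [C]
  have c1 : C₁ ≤ C := by simp [C]
  have c2 : C₂ ≤ C := by simp [C]
  refine ⟨C, le_max_left _ _, fun z hz => ⟨(h₀ z hz).trans c0, (h₁ z hz).trans c1⟩,
    fun z hz w hw => ⟨?_, ?_⟩⟩
  · exact (convex_closedBall (0:E3) R).norm_image_sub_le_of_norm_fderiv_le (𝕜 := ℝ)
      (fun z _ => (hG.differentiable (by norm_num)) z) (fun z hz => (h₁ z hz).trans c1) hw hz
  · exact (convex_closedBall (0:E3) R).norm_image_sub_le_of_norm_fderiv_le (𝕜 := ℝ)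
      (fun z _ => (hG1.differentiable (by norm_num)) z) (fun z hz => (h₂ z hz).trans c2) hw hz

/-- Velocity induced at parameter `ξ` by the curve `γ` with derivative `g`, for the kernel `G` and
the bilinear product `B`. -/
def inducedVel (G : E3 → E3) (B : E3 →L[ℝ] E3 →L[ℝ] E3) (γ g : ℝ → E3) (ξ : ℝ) : E3 :=
  ∫ η, B (G (γ ξ - γ η)) (g η) ∂unitVol

/-- The derivative of `inducedVel` with respect to the parameter. -/
def inducedVelDeriv (G : E3 → E3) (B : E3 →L[ℝ] E3 →L[ℝ] E3) (γ g : ℝ → E3) (ξ : ℝ) : E3 :=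
  ∫ η, B (fderiv ℝ G (γ ξ - γ η) (g ξ)) (g η) ∂unitVol

/-- `γ` is a primitive of the integrable function `g` on the unit interval. -/
structure IsPrimitive (γ g : ℝ → E3) : Prop where
  eq_add : ∀ ξ ∈ Icc (0:ℝ) 1, γ ξ = γ 0 + ∫ s in (0:ℝ)..ξ, g s
  integrable : Integrable g unitVol

namespace IsPrimitive

variable {γ g γ₁ g₁ γ₂ g₂ : ℝ → E3}

theorem sub_eq (h : IsPrimitive γ g) {ξ η : ℝ} (hξ : ξ ∈ Icc (0:ℝ) 1) (hη : η ∈ Icc (0:ℝ) 1) :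
    γ ξ - γ η = ∫ s in η..ξ, g s := by
  have h0 : (0:ℝ) ∈ Icc (0:ℝ) 1 := by simp
  rw [h.eq_add ξ hξ, h.eq_add η hη, add_sub_add_left_eq_sub]
  exact intervalIntegral.integral_interval_sub_left
    (intervalIntegrable_of_unitVol h.integrable h0 hξ)
    (intervalIntegrable_of_unitVol h.integrable h0 hη)

theorem norm_sub_le (h : IsPrimitive γ g) {ξ η : ℝ} (hξ : ξ ∈ Icc (0:ℝ) 1)
    (hη : η ∈ Icc (0:ℝ) 1) : ‖γ ξ - γ η‖ ≤ ∫ s, ‖g s‖ ∂unitVol := by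
  rw [h.sub_eq hξ hη]
  exact norm_intervalIntegral_le_unitVol h.integrable hη hξ

theorem continuousOn (h : IsPrimitive γ g) : ContinuousOn γ (Icc 0 1) := by
  have := intervalIntegral.continuousOn_primitive_interval'
    (intervalIntegrable_of_unitVol h.integrable (x := 0) (y := 1) (by simp) (by simp))
    (a := 0) (by simp)
  rw [uIcc_of_le zero_le_one] at this
  exact (continuousOn_const.add this).congr h.eq_add

theorem sub (h₁ : IsPrimitive γ₁ g₁) (h₂ : IsPrimitive γ₂ g₂) :
    IsPrimitive (γ₁ - γ₂) (g₁ - g₂) where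
  eq_add ξ hξ := by
    have h0 : (0:ℝ) ∈ Icc (0:ℝ) 1 := by simp
    simp only [Pi.sub_apply]
    rw [intervalIntegral.integral_sub (intervalIntegrable_of_unitVol h₁.integrable h0 hξ)
      (intervalIntegrable_of_unitVol h₂.integrable h0 hξ), h₁.eq_add ξ hξ, h₂.eq_add ξ hξ]
    abel
  integrable := h₁.integrable.sub h₂.integrable

theorem comp_eq (h : IsPrimitive γ g) {F : Type*} [NormedAddCommGroup F] [NormedSpace ℝ F]
    [CompleteSpace F] {Φ : E3 → F} (hΦ : ContDiff ℝ 1 Φ) {ξ : ℝ} (hξ : ξ ∈ Icc (0:ℝ) 1) :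
    Φ (γ ξ) = Φ (γ 0) + ∫ s in (0:ℝ)..ξ, fderiv ℝ Φ (γ s) (g s) := by
  rw [h.eq_add ξ hξ, comp_primitive_eq hΦ
    (intervalIntegrable_of_unitVol h.integrable (by simp) (by simp)) _ hξ]
  congr 1
  refine intervalIntegral.integral_congr fun s hs => ?_
  have hs' := uIcc_subset_Icc (by simp : (0:ℝ) ∈ Icc (0:ℝ) 1) hξ hs
  rw [← h.eq_add s hs']

theorem mem_closedBall (h : IsPrimitive γ g) {M : ℝ} (hM : ∫ s, ‖g s‖ ∂unitVol ≤ M) {ξ η : ℝ}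
    (hξ : ξ ∈ Icc (0:ℝ) 1) (hη : η ∈ Icc (0:ℝ) 1) : γ ξ - γ η ∈ Metric.closedBall (0:E3) M := by
  rw [mem_closedBall_zero_iff]
  exact (h.norm_sub_le hξ hη).trans hM

theorem continuousOn_kernel (h : IsPrimitive γ g) {F : Type*} [TopologicalSpace F] {Φ : E3 → F}
    (hΦ : Continuous Φ) (p : E3) : ContinuousOn (fun η => Φ (p - γ η)) (Icc 0 1) :=
  hΦ.comp_continuousOn (continuousOn_const.sub h.continuousOn)

/-- Integration by parts along closed curves. -/
theorem integral_bilin_parts (hG : ContDiff ℝ 1 G) (h₁ : IsPrimitive γ₁ g₁) (hc₁ : γ₁ 0 = γ₁ 1)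
    (h₂ : IsPrimitive γ₂ g₂) (hc₂ : γ₂ 0 = γ₂ 1) (p : E3) :
    ∫ η, B (G (p - γ₁ η)) (g₂ η) ∂unitVol =
      ∫ η, B (fderiv ℝ G (p - γ₁ η) (g₁ η)) (γ₂ η) ∂unitVol := by
  have h0 : (0:ℝ) ∈ Icc (0:ℝ) 1 := by simp
  have h1 : (1:ℝ) ∈ Icc (0:ℝ) 1 := by simp
  let Φ : E3 × E3 → E3 := fun q => B (G (p - q.1)) q.2
  have hΦ : ContDiff ℝ 1 Φ := by
    have : ContDiff ℝ 1 (fun q : E3 × E3 => G (p - q.1)) := by fun_prop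
    exact (B.contDiff.comp this).clm_apply contDiff_snd
  have hd : ∀ q v : E3 × E3, fderiv ℝ Φ q v =
      B (G (p - q.1)) v.2 - B (fderiv ℝ G (p - q.1) v.1) q.2 := by
    intro q v
    have hg : HasFDerivAt (fun q : E3 × E3 => G (p - q.1))
        ((fderiv ℝ G (p - q.1)).comp (-(ContinuousLinearMap.fst ℝ E3 E3))) q :=
      ((hG.differentiable (by norm_num)) (p - q.1)).hasFDerivAt.comp q
        ((hasFDerivAt_fst (p := q)).const_sub p)
    have := B.hasFDerivAt_of_bilinear hg (hasFDerivAt_snd (p := q))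
    rw [show Φ = fun y : E3 × E3 => B (G (p - y.1)) y.2 from rfl, this.fderiv]
    simp [sub_eq_add_neg]
  have hu : Integrable (fun s => (g₁ s, g₂ s)) unitVol := h₁.integrable.prodMk h₂.integrable
  have hU : ∀ ξ ∈ Icc (0:ℝ) 1,
      (γ₁ 0, γ₂ 0) + ∫ s in (0:ℝ)..ξ, (g₁ s, g₂ s) = (γ₁ ξ, γ₂ ξ) := by
    intro ξ hξ
    have hI : IntegrableOn (fun s => (g₁ s, g₂ s)) (Ioc 0 ξ) :=
      (intervalIntegrable_iff_integrableOn_Ioc_of_le hξ.1).1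
        (intervalIntegrable_of_unitVol hu h0 hξ)
    rw [h₁.eq_add ξ hξ, h₂.eq_add ξ hξ, intervalIntegral.integral_of_le hξ.1,
      intervalIntegral.integral_of_le hξ.1, intervalIntegral.integral_of_le hξ.1,
      integral_pair hI.fst hI.snd]
    rfl
  have key := comp_primitive_eq hΦ (intervalIntegrable_of_unitVol hu h0 h1) (γ₁ 0, γ₂ 0) h1
  rw [hU 1 h1, ← hc₁, ← hc₂, eq_comm, add_eq_left, intervalIntegral.integral_of_le zero_le_one] at key
  rw [← sub_eq_zero, ← key, ← integral_sub]
  · refine setIntegral_congr_fun measurableSet_Ioc fun s hs => ?_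
    rw [hU s (Ioc_subset_Icc_self hs), hd]
  · exact integrable_bilin B (h₁.continuousOn_kernel hG.continuous p) h₂.integrable
  · exact integrable_bilin B.flip h₂.continuousOn (integrable_bilin (.id ℝ _)
      (h₁.continuousOn_kernel (hG.continuous_fderiv (by norm_num)) p) h₁.integrable)

end IsPrimitive

end Kernel

section Velocity

variable {G : E3 → E3} {B : E3 →L[ℝ] E3 →L[ℝ] E3}

/-- The induced velocity is controlled, in the supremum norm, by the curve alone as long as the
derivatives stay bounded: closed curves allow integration by parts. -/
theorem exists_inducedVel_sub_le (hG : ContDiff ℝ 2 G) (B : E3 →L[ℝ] E3 →L[ℝ] E3) (M : ℝ) :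
    ∃ K : ℝ, ∀ γ₁ g₁ γ₂ g₂ : ℝ → E3, IsPrimitive γ₁ g₁ → γ₁ 0 = γ₁ 1 →
      IsPrimitive γ₂ g₂ → γ₂ 0 = γ₂ 1 →
      (∫ s, ‖g₁ s‖ ∂unitVol) ≤ M → (∫ s, ‖g₂ s‖ ∂unitVol) ≤ M →
      ∀ D : ℝ, (∀ η ∈ Icc (0:ℝ) 1, ‖γ₁ η - γ₂ η‖ ≤ D) → ∀ ξ ∈ Icc (0:ℝ) 1,
        ‖inducedVel G B γ₁ g₁ ξ - inducedVel G B γ₂ g₂ ξ‖ ≤ K * D := by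
  obtain ⟨C, hC0, hC, hL⟩ := exists_kernel_bound hG M
  refine ⟨3 * ‖B‖ * C * M, fun γ₁ g₁ γ₂ g₂ h₁ hc₁ h₂ hc₂ hM₁ hM₂ D hD ξ hξ => ?_⟩
  have hD0 : 0 ≤ D := (norm_nonneg _).trans (hD 0 (by simp))
  have hG1 : ContDiff ℝ 1 G := hG.of_le (by norm_num)
  have hH₁ := h₁.continuousOn_kernel hG.continuous (γ₁ ξ)
  have hH₂ := h₂.continuousOn_kernel hG.continuous (γ₂ ξ)
  have i₁ : Integrable (fun η => B (G (γ₁ ξ - γ₁ η) - G (γ₂ ξ - γ₂ η)) (g₁ η)) unitVol :=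
    integrable_bilin B (hH₁.sub hH₂) h₁.integrable
  have i₂ : Integrable (fun η => B (G (γ₂ ξ - γ₂ η)) ((g₁ - g₂) η)) unitVol :=
    integrable_bilin B hH₂ (h₁.integrable.sub h₂.integrable)
  have e : inducedVel G B γ₁ g₁ ξ - inducedVel G B γ₂ g₂ ξ =
      (∫ η, B (G (γ₁ ξ - γ₁ η) - G (γ₂ ξ - γ₂ η)) (g₁ η) ∂unitVol) +
        ∫ η, B (G (γ₂ ξ - γ₂ η)) ((g₁ - g₂) η) ∂unitVol := by
    rw [inducedVel, inducedVel, ← integral_sub (integrable_bilin B hH₁ h₁.integrable)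
      (integrable_bilin B hH₂ h₂.integrable), ← integral_add i₁ i₂]
    congr with η
    simp
  rw [e, h₂.integral_bilin_parts hG1 hc₂ (h₁.sub h₂) (by simp [hc₁, hc₂])]
  have hb₁ : ‖∫ η, B (G (γ₁ ξ - γ₁ η) - G (γ₂ ξ - γ₂ η)) (g₁ η) ∂unitVol‖ ≤
      ‖B‖ * (C * (2 * D)) * ∫ s, ‖g₁ s‖ ∂unitVol := by
    refine norm_integral_bilin_le (H := fun η => G (γ₁ ξ - γ₁ η) - G (γ₂ ξ - γ₂ η)) B
      (fun η hη => ?_) h₁.integrable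
    refine ((hL _ (h₁.mem_closedBall hM₁ hξ hη) _ (h₂.mem_closedBall hM₂ hξ hη)).1).trans ?_
    gcongr
    rw [sub_sub_sub_comm, two_mul]
    exact (norm_sub_le _ _).trans (add_le_add (hD ξ hξ) (hD η hη))
  have hI : Integrable (fun η => fderiv ℝ G (γ₂ ξ - γ₂ η) (g₂ η)) unitVol :=
    integrable_bilin (.id ℝ _)
      (h₂.continuousOn_kernel (hG.continuous_fderiv (by norm_num)) _) h₂.integrable
  have hb₂ := norm_integral_bilin_le (H := γ₁ - γ₂) B.flip hD hI
  rw [B.opNorm_flip] at hb₂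
  have hb₃ : ∫ η, ‖fderiv ℝ G (γ₂ ξ - γ₂ η) (g₂ η)‖ ∂unitVol ≤ C * ∫ s, ‖g₂ s‖ ∂unitVol := by
    rw [← integral_const_mul]
    refine integral_mono_ae hI.norm (h₂.integrable.norm.const_mul C)
      ((ae_restrict_iff' measurableSet_Ioc).2 (Filter.Eventually.of_forall fun s hs => ?_))
    exact (ContinuousLinearMap.le_opNorm _ _).trans (mul_le_mul_of_nonneg_right
      (hC _ (h₂.mem_closedBall hM₂ hξ (Ioc_subset_Icc_self hs))).2 (norm_nonneg _))
  refine (norm_add_le _ _).trans ?_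
  calc _ ≤ ‖B‖ * (C * (2 * D)) * M + ‖B‖ * D * (C * M) := by
        refine add_le_add (hb₁.trans (by gcongr)) (hb₂.trans ?_)
        gcongr
        exact hb₃.trans (by gcongr)
    _ = _ := by ring

theorem exists_inducedVel_param_sub_le (hG : ContDiff ℝ 2 G) (B : E3 →L[ℝ] E3 →L[ℝ] E3) (M : ℝ) :
    ∃ K : ℝ, ∀ γ g : ℝ → E3, IsPrimitive γ g → (∫ s, ‖g s‖ ∂unitVol) ≤ M →
      ∀ ξ ∈ Icc (0:ℝ) 1, ∀ ζ ∈ Icc (0:ℝ) 1,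
        ‖inducedVel G B γ g ξ - inducedVel G B γ g ζ‖ ≤ K * ‖γ ξ - γ ζ‖ := by
  obtain ⟨C, hC0, hC, hL⟩ := exists_kernel_bound hG M
  refine ⟨‖B‖ * C * M, fun γ g h hM ξ hξ ζ hζ => ?_⟩
  have := norm_integral_bilin_sub_le (δ := C * ‖γ ξ - γ ζ‖) B
    (h.continuousOn_kernel hG.continuous (γ ξ))
    (h.continuousOn_kernel hG.continuous (γ ζ)) h.integrable h.integrable
    (fun η hη => by
      have := (hL _ (h.mem_closedBall hM hξ hη) _ (h.mem_closedBall hM hζ hη)).1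
      rwa [sub_sub_sub_cancel_right] at this)
    (fun η hη => (hC _ (h.mem_closedBall hM hζ hη)).1) hM
  refine this.trans_eq ?_
  simp only [sub_self, norm_zero, integral_zero, mul_zero, add_zero]
  ring

theorem IsPrimitive.continuousOn_inducedVel {γ g : ℝ → E3} (h : IsPrimitive γ g)
    (hG : ContDiff ℝ 2 G) : ContinuousOn (inducedVel G B γ g) (Icc 0 1) := by
  obtain ⟨K, hK⟩ := exists_inducedVel_param_sub_le hG B (∫ s, ‖g s‖ ∂unitVol)
  intro ζ hζ
  have h2 := h.continuousOn ζ hζ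
  rw [ContinuousWithinAt, tendsto_iff_norm_sub_tendsto_zero] at h2 ⊢
  have h3 := h2.const_mul K
  rw [mul_zero] at h3
  refine squeeze_zero' (Filter.Eventually.of_forall fun _ => norm_nonneg _) ?_ h3
  filter_upwards [self_mem_nhdsWithin] with ξ hξ using hK γ g h le_rfl ξ hξ ζ hζ

theorem IsPrimitive.aestronglyMeasurable {γ g : ℝ → E3} (h : IsPrimitive γ g) :
    AEStronglyMeasurable γ unitVol :=
  (h.continuousOn.mono Ioc_subset_Icc_self).aestronglyMeasurable measurableSet_Ioc

theorem IsPrimitive.integrable_prod {γ g : ℝ → E3} (h : IsPrimitive γ g) (hG : ContDiff ℝ 2 G)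
    (B : E3 →L[ℝ] E3 →L[ℝ] E3) {ξ : ℝ} (hξ : ξ ≤ 1) :
    Integrable (fun q : ℝ × ℝ => B (fderiv ℝ G (γ q.1 - γ q.2) (g q.1)) (g q.2))
      ((volume.restrict (Ioc 0 ξ)).prod unitVol) := by
  have hle : volume.restrict (Ioc 0 ξ) ≤ unitVol :=
    Measure.restrict_mono (Ioc_subset_Ioc_right hξ) le_rfl
  obtain ⟨C, hC0, hC, -⟩ := exists_kernel_bound hG (∫ s, ‖g s‖ ∂unitVol)
  have hg := h.integrable.mono_measure hle
  refine Integrable.mono' ((hg.norm.mul_prod h.integrable.norm).const_mul (‖B‖ * C)) ?_ ?_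
  · have m₁ : AEStronglyMeasurable (fun q : ℝ × ℝ => fderiv ℝ G (γ q.1 - γ q.2))
        ((volume.restrict (Ioc 0 ξ)).prod unitVol) :=
      (hG.continuous_fderiv (by norm_num)).comp_aestronglyMeasurable
        ((h.aestronglyMeasurable.mono_measure hle).comp_fst.sub h.aestronglyMeasurable.comp_snd)
    have m₂ := (ContinuousLinearMap.id ℝ (E3 →L[ℝ] E3)).aestronglyMeasurable_comp₂ m₁
      (hg.1.comp_fst (ν := unitVol))
    exact B.aestronglyMeasurable_comp₂ m₂ h.integrable.1.comp_snd
  · rw [Measure.prod_restrict]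
    refine (ae_restrict_iff' (measurableSet_Ioc.prod measurableSet_Ioc)).2
      (Filter.Eventually.of_forall fun q hq => ?_)
    have h₁ : q.1 ∈ Icc (0:ℝ) 1 := ⟨hq.1.1.le, hq.1.2.trans hξ⟩
    have h₂ : q.2 ∈ Icc (0:ℝ) 1 := Ioc_subset_Icc_self hq.2
    have hc := (hC _ (h.mem_closedBall le_rfl h₁ h₂)).2
    calc _ ≤ ‖B‖ * ‖fderiv ℝ G (γ q.1 - γ q.2) (g q.1)‖ * ‖g q.2‖ := B.le_opNorm₂ _ _
      _ ≤ ‖B‖ * (C * ‖g q.1‖) * ‖g q.2‖ := by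
        gcongr
        exact (ContinuousLinearMap.le_opNorm _ _).trans (by gcongr)
      _ = _ := by ring

theorem IsPrimitive.inducedVel_eq_add {γ g : ℝ → E3} (h : IsPrimitive γ g) (hG : ContDiff ℝ 2 G)
    {ξ : ℝ} (hξ : ξ ∈ Icc (0:ℝ) 1) :
    inducedVel G B γ g ξ = inducedVel G B γ g 0 + ∫ s in (0:ℝ)..ξ, inducedVelDeriv G B γ g s := by
  have h0 : (0:ℝ) ∈ Icc (0:ℝ) 1 := by simp
  rw [intervalIntegral.integral_of_le hξ.1]
  unfold inducedVelDeriv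
  rw [integral_integral_swap (h.integrable_prod hG B hξ.2), ← sub_eq_iff_eq_add', inducedVel,
    inducedVel, ← integral_sub
      (integrable_bilin B (h.continuousOn_kernel hG.continuous _) h.integrable)
      (integrable_bilin B (h.continuousOn_kernel hG.continuous _) h.integrable)]
  refine setIntegral_congr_fun measurableSet_Ioc fun η hη => ?_
  have hη' : η ∈ Icc (0:ℝ) 1 := Ioc_subset_Icc_self hη
  have hc : ContDiff ℝ 1 (fun z => G (z - γ η)) :=
    (hG.of_le (by norm_num)).comp (contDiff_id.sub contDiff_const)
  have e := h.comp_eq hc hξ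
  simp only [fderiv_comp_sub] at e
  have hI : IntervalIntegrable (fun s => fderiv ℝ G (γ s - γ η) (g s)) volume 0 ξ := by
    have : Integrable (fun s => fderiv ℝ G (γ s - γ η) (g s)) unitVol :=
      integrable_bilin (.id ℝ _) ((hG.continuous_fderiv (by norm_num)).comp_continuousOn
        (h.continuousOn.sub continuousOn_const)) h.integrable
    exact intervalIntegrable_of_unitVol this h0 hξ
  have e2 := (B.flip (g η)).intervalIntegral_comp_comm hI
  rw [intervalIntegral.integral_of_le hξ.1] at e2
  simp only [ContinuousLinearMap.flip_apply] at e2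
  rw [e2, e]
  simp

theorem exists_inducedVelDeriv_sub_le (hG : ContDiff ℝ 2 G) (B : E3 →L[ℝ] E3 →L[ℝ] E3) (M : ℝ) :
    ∃ K : ℝ, 0 ≤ K ∧ ∀ γ₁ g₁ γ₂ g₂ : ℝ → E3, IsPrimitive γ₁ g₁ → IsPrimitive γ₂ g₂ →
      (∫ s, ‖g₁ s‖ ∂unitVol) ≤ M → (∫ s, ‖g₂ s‖ ∂unitVol) ≤ M →
      ∀ D : ℝ, (∀ η ∈ Icc (0:ℝ) 1, ‖γ₁ η - γ₂ η‖ ≤ D) →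
        (∫ s, ‖g₁ s - g₂ s‖ ∂unitVol) ≤ D → ∀ ξ ∈ Icc (0:ℝ) 1,
        ‖inducedVel G B γ₁ g₁ ξ - inducedVel G B γ₂ g₂ ξ‖ ≤ K * D ∧
        ‖inducedVelDeriv G B γ₁ g₁ ξ - inducedVelDeriv G B γ₂ g₂ ξ‖ ≤
          K * ‖g₁ ξ - g₂ ξ‖ + K * D * ‖g₂ ξ‖ := by
  obtain ⟨C, hC0, hC, hL⟩ := exists_kernel_bound hG M
  refine ⟨‖B‖ * C * (2 * |M| + 1), by positivity,
    fun γ₁ g₁ γ₂ g₂ h₁ h₂ hM₁ hM₂ D hD hD' ξ hξ => ?_⟩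
  have hM0 : 0 ≤ M := (integral_nonneg fun _ => norm_nonneg _).trans hM₁
  have hD0 : 0 ≤ D := (norm_nonneg _).trans (hD 0 (by simp))
  rw [abs_of_nonneg hM0]
  have hdG := hG.continuous_fderiv (by norm_num)
  have hdiff : ∀ η ∈ Icc (0:ℝ) 1, ‖γ₁ ξ - γ₁ η - (γ₂ ξ - γ₂ η)‖ ≤ 2 * D := by
    intro η hη
    rw [sub_sub_sub_comm, two_mul]
    exact (norm_sub_le _ _).trans (add_le_add (hD ξ hξ) (hD η hη))
  constructor
  · refine (norm_integral_bilin_sub_le (δ := C * (2 * D)) (c := C) B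
      (h₁.continuousOn_kernel hG.continuous (γ₁ ξ)) (h₂.continuousOn_kernel hG.continuous (γ₂ ξ))
      h₁.integrable h₂.integrable (fun η hη => ?_)
      (fun η hη => (hC _ (h₂.mem_closedBall hM₂ hξ hη)).1) hM₁).trans ?_
    · exact ((hL _ (h₁.mem_closedBall hM₁ hξ hη) _ (h₂.mem_closedBall hM₂ hξ hη)).1).trans
        (mul_le_mul_of_nonneg_left (hdiff η hη) hC0)
    · calc _ ≤ ‖B‖ * (C * (2 * D) * M + C * D) := by gcongr
        _ = _ := by ring
  · refine (norm_integral_bilin_sub_le (H₁ := fun η => fderiv ℝ G (γ₁ ξ - γ₁ η) (g₁ ξ))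
      (H₂ := fun η => fderiv ℝ G (γ₂ ξ - γ₂ η) (g₂ ξ))
      (δ := C * ‖g₁ ξ - g₂ ξ‖ + C * (2 * D) * ‖g₂ ξ‖) (c := C * ‖g₂ ξ‖) B
      ((h₁.continuousOn_kernel hdG (γ₁ ξ)).clm_apply continuousOn_const)
      ((h₂.continuousOn_kernel hdG (γ₂ ξ)).clm_apply continuousOn_const)
      h₁.integrable h₂.integrable (fun η hη => ?_) (fun η hη => ?_) hM₁).trans ?_
    · have b₁ := h₁.mem_closedBall hM₁ hξ hη
      have b₂ := h₂.mem_closedBall hM₂ hξ hη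
      have e : fderiv ℝ G (γ₁ ξ - γ₁ η) (g₁ ξ) - fderiv ℝ G (γ₂ ξ - γ₂ η) (g₂ ξ) =
          fderiv ℝ G (γ₁ ξ - γ₁ η) (g₁ ξ - g₂ ξ) +
            (fderiv ℝ G (γ₁ ξ - γ₁ η) - fderiv ℝ G (γ₂ ξ - γ₂ η)) (g₂ ξ) := by simp
      rw [e]
      refine (norm_add_le _ _).trans (add_le_add ?_ ?_)
      · exact (ContinuousLinearMap.le_opNorm _ _).trans
          (mul_le_mul_of_nonneg_right (hC _ b₁).2 (norm_nonneg _))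
      · refine (ContinuousLinearMap.le_opNorm _ _).trans
          (mul_le_mul_of_nonneg_right ?_ (norm_nonneg _))
        exact ((hL _ b₁ _ b₂).2).trans (mul_le_mul_of_nonneg_left (hdiff η hη) hC0)
    · exact (ContinuousLinearMap.le_opNorm _ _).trans (mul_le_mul_of_nonneg_right
        (hC _ (h₂.mem_closedBall hM₂ hξ hη)).2 (norm_nonneg _))
    · have hp : 0 ≤ ‖B‖ * C * (M + 1) * ‖g₁ ξ - g₂ ξ‖ := by positivity
      calc _ ≤ ‖B‖ * ((C * ‖g₁ ξ - g₂ ξ‖ + C * (2 * D) * ‖g₂ ξ‖) * M + C * ‖g₂ ξ‖ * D) := by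
            gcongr
        _ ≤ _ := by linarith

end Velocity

section PhaseSpace

theorem integral_norm_le_sqrt {E : Type*} [NormedAddCommGroup E] {g : ℝ → E}
    (hg : MemLp g 2 unitVol) :
    ∫ s, ‖g s‖ ∂unitVol ≤ √(∫ s, ‖g s‖ ^ 2 ∂unitVol) := by
  refine Real.le_sqrt_of_sq_le ?_
  have i₁ : Integrable (fun s => ‖g s‖) unitVol := (hg.integrable one_le_two).norm
  have i₂ : Integrable (fun s => ‖g s‖ ^ 2) unitVol := hg.integrable_norm_pow (by norm_num)
  set m := ∫ s, ‖g s‖ ∂unitVol with hm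
  have h0 : 0 ≤ ∫ s, (‖g s‖ - m) ^ 2 ∂unitVol := integral_nonneg fun s => sq_nonneg _
  have e : ∫ s, (‖g s‖ - m) ^ 2 ∂unitVol = (∫ s, ‖g s‖ ^ 2 ∂unitVol) - 2 * m * m + m ^ 2 := by
    have : ∀ s, (‖g s‖ - m) ^ 2 = ‖g s‖ ^ 2 - 2 * m * ‖g s‖ + m ^ 2 := fun s => by ring
    simp_rw [this]
    have i₃ : Integrable (fun s => ‖g s‖ ^ 2 - 2 * m * ‖g s‖) unitVol := i₂.sub (i₁.const_mul _)
    rw [integral_add i₃ (integrable_const _),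
      integral_sub i₂ (i₁.const_mul _), integral_const_mul, ← hm]
    simp
  nlinarith

theorem L2_norm_eq_sqrt (g : Lp E3 2 unitVol) : ‖g‖ = √(∫ s, ‖g s‖ ^ 2 ∂unitVol) := by
  rw [eq_comm, Real.sqrt_eq_iff_mul_self_eq (integral_nonneg fun s => by positivity) (norm_nonneg _),
    ← real_inner_self_eq_norm_mul_norm, L2.inner_def]
  simp

theorem L2_norm_toLp_eq_sqrt {g : ℝ → E3} (hg : MemLp g 2 unitVol) :
    ‖hg.toLp g‖ = √(∫ s, ‖g s‖ ^ 2 ∂unitVol) := by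
  rw [L2_norm_eq_sqrt]
  congr 1
  refine integral_congr_ae ?_
  filter_upwards [hg.coeFn_toLp] with s hs
  rw [hs]

theorem integral_norm_le_L2_norm (g : Lp E3 2 unitVol) : ∫ s, ‖g s‖ ∂unitVol ≤ ‖g‖ := by
  rw [L2_norm_eq_sqrt]
  exact integral_norm_le_sqrt (Lp.memLp g)

theorem Lp_integrable (g : Lp E3 2 unitVol) : Integrable g unitVol :=
  (Lp.memLp g).integrable one_le_two

theorem Lp_norm_le_of_ae_le_add {f a b : Lp E3 2 unitVol} {c d : ℝ} (hc : 0 ≤ c) (hd : 0 ≤ d)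
    (h : ∀ᵐ s ∂unitVol, ‖f s‖ ≤ c * ‖a s‖ + d * ‖b s‖) : ‖f‖ ≤ c * ‖a‖ + d * ‖b‖ := by
  have ha := (Lp.memLp a).norm
  have hb := (Lp.memLp b).norm
  have e : ∀ (u : Lp E3 2 unitVol), ‖(Lp.memLp u).norm.toLp‖ = ‖u‖ := by
    intro u
    rw [Lp.norm_toLp, eLpNorm_norm, Lp.norm_def]
  have h1 : ‖f‖ ≤ ‖c • ha.toLp + d • hb.toLp‖ := by
    refine Lp.norm_le_norm_of_ae_le ?_
    filter_upwards [h, Lp.coeFn_add (c • ha.toLp) (d • hb.toLp), Lp.coeFn_smul c ha.toLp,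
      Lp.coeFn_smul d hb.toLp, ha.coeFn_toLp, hb.coeFn_toLp] with s h₁ h₂ h₃ h₄ h₅ h₆
    rw [h₂, Pi.add_apply, h₃, h₄, Pi.smul_apply, Pi.smul_apply, h₅, h₆]
    exact h₁.trans (le_abs_self _)
  refine h1.trans ((norm_add_le _ _).trans_eq ?_)
  rw [norm_smul, norm_smul, e, e, Real.norm_of_nonneg hc, Real.norm_of_nonneg hd]

/-- A curve on the unit interval with square integrable derivative, given by its initial point and
its derivative. -/
abbrev CurveSpace := E3 × Lp E3 2 unitVol

/-- Integration over `(0, ξ]` as a continuous linear map on `L²`. -/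
def integralL (ξ : ℝ) : Lp E3 2 unitVol →L[ℝ] E3 :=
  LinearMap.mkContinuous
    { toFun := fun g => ∫ s in Ioc 0 ξ, g s ∂unitVol
      map_add' := fun g h => by
        rw [← integral_add (Lp_integrable g).restrict (Lp_integrable h).restrict]
        exact integral_congr_ae (ae_restrict_of_ae (Lp.coeFn_add g h))
      map_smul' := fun c g => by
        rw [RingHom.id_apply, ← integral_smul]
        exact integral_congr_ae (ae_restrict_of_ae (Lp.coeFn_smul c g)) } 1 fun g => by
    rw [one_mul]
    refine (norm_integral_le_integral_norm _).trans (le_trans ?_ (integral_norm_le_L2_norm g))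
    exact setIntegral_le_integral (Lp_integrable g).norm
      (Filter.Eventually.of_forall fun _ => norm_nonneg _)

/-- Evaluation of a curve at the parameter `ξ`. -/
def evalL (ξ : ℝ) : CurveSpace →L[ℝ] E3 :=
  ContinuousLinearMap.fst ℝ _ _ + (integralL ξ).comp (ContinuousLinearMap.snd ℝ _ _)

theorem evalL_apply (x : CurveSpace) {ξ : ℝ} (hξ : ξ ∈ Icc (0:ℝ) 1) :
    evalL ξ x = x.1 + ∫ s in (0:ℝ)..ξ, x.2 s := by
  have : evalL ξ x = x.1 + ∫ s in Ioc 0 ξ, x.2 s ∂unitVol := rfl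
  rw [this, intervalIntegral.integral_of_le hξ.1, Measure.restrict_restrict measurableSet_Ioc,
    inter_eq_left.2 (Ioc_subset_Ioc_right hξ.2)]

theorem evalL_zero (x : CurveSpace) : evalL 0 x = x.1 := by
  rw [evalL_apply x (by simp)]
  simp

theorem norm_evalL_le (x : CurveSpace) (ξ : ℝ) : ‖evalL ξ x‖ ≤ 2 * ‖x‖ := by
  have h : ‖integralL ξ x.2‖ ≤ 1 * ‖x.2‖ :=
    (integralL ξ).le_of_opNorm_le (LinearMap.mkContinuous_norm_le _ zero_le_one _) _
  calc ‖x.1 + integralL ξ x.2‖ ≤ ‖x.1‖ + ‖integralL ξ x.2‖ := norm_add_le _ _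
    _ ≤ ‖x‖ + ‖x‖ := add_le_add (norm_fst_le x) (h.trans (by simpa using norm_snd_le x))
    _ = _ := by ring

theorem isPrimitive_evalL (x : CurveSpace) : IsPrimitive (fun ξ => evalL ξ x) x.2 where
  eq_add ξ hξ := by rw [evalL_zero, evalL_apply x hξ]
  integrable := Lp_integrable x.2

theorem evalL_sub_norm_le (x y : CurveSpace) (ξ : ℝ) : ‖evalL ξ x - evalL ξ y‖ ≤ 2 * ‖x - y‖ := by
  rw [← map_sub]
  exact norm_evalL_le _ _

variable {G : E3 → E3}

theorem IsPrimitive.memLp_inducedVelDeriv {γ g : ℝ → E3} (h : IsPrimitive γ g)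
    (hg : MemLp g 2 unitVol) (hG : ContDiff ℝ 2 G) (B : E3 →L[ℝ] E3 →L[ℝ] E3) :
    MemLp (inducedVelDeriv G B γ g) 2 unitVol := by
  obtain ⟨C, hC0, hC, -⟩ := exists_kernel_bound hG (∫ s, ‖g s‖ ∂unitVol)
  refine hg.of_le_mul (c := ‖B‖ * C * ∫ s, ‖g s‖ ∂unitVol)
    (h.integrable_prod hG B le_rfl).1.integral_prod_right' ?_
  refine (ae_restrict_iff' measurableSet_Ioc).2 (Filter.Eventually.of_forall fun ξ hξ => ?_)
  refine (norm_integral_bilin_le (H := fun η => fderiv ℝ G (γ ξ - γ η) (g ξ)) (c := C * ‖g ξ‖) B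
    (fun η hη => ?_) h.integrable).trans_eq (by ring)
  exact (ContinuousLinearMap.le_opNorm _ _).trans (mul_le_mul_of_nonneg_right
    (hC _ (h.mem_closedBall le_rfl (Ioc_subset_Icc_self hξ) hη)).2 (norm_nonneg _))

/-- The induced velocity as a vector field on the space of curves. -/
def velField (hG : ContDiff ℝ 2 G) (B : E3 →L[ℝ] E3 →L[ℝ] E3) (x : CurveSpace) : CurveSpace :=
  (inducedVel G B (fun ξ => evalL ξ x) x.2 0,
    ((isPrimitive_evalL x).memLp_inducedVelDeriv (Lp.memLp x.2) hG B).toLp)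

theorem evalL_velField (hG : ContDiff ℝ 2 G) (B : E3 →L[ℝ] E3 →L[ℝ] E3) (x : CurveSpace) {ξ : ℝ}
    (hξ : ξ ∈ Icc (0:ℝ) 1) :
    evalL ξ (velField hG B x) = inducedVel G B (fun ξ => evalL ξ x) x.2 ξ := by
  rw [evalL_apply _ hξ, (isPrimitive_evalL x).inducedVel_eq_add hG hξ]
  congr 1
  rw [intervalIntegral.integral_of_le hξ.1, intervalIntegral.integral_of_le hξ.1]
  exact integral_congr_ae (ae_restrict_of_ae_restrict_of_subset (Ioc_subset_Ioc_right hξ.2)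
    (MemLp.coeFn_toLp ((isPrimitive_evalL x).memLp_inducedVelDeriv (Lp.memLp x.2) hG B)))

theorem exists_lipschitzOnWith_velField (hG : ContDiff ℝ 2 G) (B : E3 →L[ℝ] E3 →L[ℝ] E3) (R : ℝ) :
    ∃ K : NNReal, LipschitzOnWith K (velField hG B) (Metric.closedBall 0 R) := by
  obtain ⟨K, hK0, hK⟩ := exists_inducedVelDeriv_sub_le hG B R
  refine ⟨Real.toNNReal (K * 2 + K + K * 2 * |R|),
    LipschitzOnWith.of_dist_le_mul fun x hx y hy => ?_⟩
  rw [mem_closedBall_zero_iff] at hx hy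
  rw [Real.coe_toNNReal _ (by positivity), dist_eq_norm, dist_eq_norm]
  have hd : ∫ s, ‖x.2 s - y.2 s‖ ∂unitVol ≤ ‖x.2 - y.2‖ := by
    refine le_trans (le_of_eq (integral_congr_ae ?_)) (integral_norm_le_L2_norm (x.2 - y.2))
    filter_upwards [Lp.coeFn_sub x.2 y.2] with s hs
    rw [hs, Pi.sub_apply]
  have hxy : ‖x.2 - y.2‖ ≤ ‖x - y‖ := norm_snd_le (x - y)
  have h := hK _ _ _ _ (isPrimitive_evalL x) (isPrimitive_evalL y)
    ((integral_norm_le_L2_norm _).trans ((norm_snd_le x).trans hx))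
    ((integral_norm_le_L2_norm _).trans ((norm_snd_le y).trans hy)) (2 * ‖x - y‖)
    (fun η _ => evalL_sub_norm_le x y η)
    (hd.trans (by linarith [norm_nonneg (x - y)]))
  have hp : 0 ≤ K * ‖x - y‖ := by positivity
  have hpR : 0 ≤ K * 2 * |R| * ‖x - y‖ := by positivity
  refine max_le ?_ ?_
  · exact ((h 0 (by simp)).1).trans (by linarith)
  · have h2 : ‖(velField hG B x).2 - (velField hG B y).2‖ ≤
        K * ‖x.2 - y.2‖ + K * (2 * ‖x - y‖) * ‖y.2‖ := by
      refine Lp_norm_le_of_ae_le_add hK0 (by positivity) ?_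
      filter_upwards [Lp.coeFn_sub (velField hG B x).2 (velField hG B y).2,
        Lp.coeFn_sub x.2 y.2, MemLp.coeFn_toLp
          ((isPrimitive_evalL x).memLp_inducedVelDeriv (Lp.memLp x.2) hG B),
        MemLp.coeFn_toLp ((isPrimitive_evalL y).memLp_inducedVelDeriv (Lp.memLp y.2) hG B),
        ae_restrict_mem measurableSet_Ioc] with s h₁ h₂ h₃ h₄ hs
      rw [h₁, h₂, Pi.sub_apply, Pi.sub_apply, velField, velField, h₃, h₄]
      exact (h s (Ioc_subset_Icc_self hs)).2
    refine h2.trans ?_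
    have hy2 : ‖y.2‖ ≤ |R| := (norm_snd_le y).trans (hy.trans (le_abs_self R))
    calc _ ≤ K * ‖x - y‖ + K * (2 * ‖x - y‖) * |R| := by gcongr
      _ ≤ _ := by linarith

end PhaseSpace

section Existence

variable {G : E3 → E3} {B : E3 →L[ℝ] E3 →L[ℝ] E3}

theorem IsH1Loop.isPrimitive {γ g : ℝ → E3} (h : IsH1Loop γ g) : IsPrimitive γ g :=
  ⟨h.deriv_eq, h.memL2.integrable one_le_two⟩

/-- A family of closed curves, with derivatives `γd`, transported by its induced velocity in
integrated form. -/
structure IsTransported (G : E3 → E3) (B : E3 →L[ℝ] E3 →L[ℝ] E3) (γ₀ : ℝ → E3) (Tstar : ℝ)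
    (γ γd : ℝ → ℝ → E3) : Prop where
  loop : ∀ t ∈ Ico (0:ℝ) Tstar, IsH1Loop (γ t) (γd t)
  bound : ∀ T' ∈ Ico (0:ℝ) Tstar, ∃ M : ℝ, ∀ t ∈ Icc (0:ℝ) T',
    (∫ ξ in Ioc (0:ℝ) 1, ‖γd t ξ‖ ^ 2) ≤ M
  lipschitz : ∀ T' ∈ Ico (0:ℝ) Tstar, ∃ K : ℝ, ∀ s ∈ Icc (0:ℝ) T', ∀ t ∈ Icc (0:ℝ) T',
    Real.sqrt (∫ ξ in Ioc (0:ℝ) 1, ‖γ t ξ - γ s ξ‖ ^ 2) ≤ K * |t - s|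
  eq_integral : ∀ t ∈ Ico (0:ℝ) Tstar, ∀ᵐ ξ ∂(volume.restrict (Ioc (0:ℝ) 1)),
    γ t ξ = γ₀ ξ + ∫ τ in (0:ℝ)..t, inducedVel G B (γ τ) (γd τ) ξ

/-- The initial point of a curve is controlled by the `L²` norms of the curve and its derivative. -/
theorem IsH1Loop.norm_zero_le {γ g : ℝ → E3} (h : IsH1Loop γ g) :
    ‖γ 0‖ ≤ √(∫ ξ in Ioc (0:ℝ) 1, ‖γ ξ‖ ^ 2) + √(∫ ξ in Ioc (0:ℝ) 1, ‖g ξ‖ ^ 2) := by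
  obtain ⟨C, hC⟩ := isCompact_Icc.exists_bound_of_continuousOn h.isPrimitive.continuousOn
  have hγ : MemLp γ 2 unitVol := MemLp.of_bound h.isPrimitive.aestronglyMeasurable C
    ((ae_restrict_iff' measurableSet_Ioc).2
      (Filter.Eventually.of_forall fun ξ hξ => hC ξ (Ioc_subset_Icc_self hξ)))
  have key : ∫ _ξ, ‖γ 0‖ ∂unitVol ≤
      ∫ ξ, (‖γ ξ‖ + ∫ s, ‖g s‖ ∂unitVol) ∂unitVol := by
    refine setIntegral_mono_on (integrable_const _)
      ((hγ.integrable one_le_two).norm.add (integrable_const _)) measurableSet_Ioc fun ξ hξ => ?_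
    have := h.isPrimitive.norm_sub_le (ξ := 0) (by simp) (Ioc_subset_Icc_self hξ)
    linarith [norm_sub_norm_le (γ 0) (γ ξ)]
  rw [integral_add (hγ.integrable one_le_two).norm (integrable_const _)] at key
  simp only [integral_const, probReal_univ, one_smul] at key
  exact key.trans (add_le_add (integral_norm_le_sqrt hγ) (integral_norm_le_sqrt h.memL2))

theorem exists_time_of_norm_le (hG : ContDiff ℝ 2 G) (B : E3 →L[ℝ] E3 →L[ℝ] E3) (r : ℝ) :
    ∃ T : ℝ, 0 < T ∧ ∀ x₀ : CurveSpace, ‖x₀‖ ≤ r → ∃ x : ℝ → CurveSpace, x 0 = x₀ ∧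
      ∀ t ∈ Icc 0 T, HasDerivWithinAt x (velField hG B (x t)) (Icc 0 T) t := by
  obtain ⟨K, hK⟩ := exists_lipschitzOnWith_velField hG B (|r| + 1)
  set L : NNReal := ‖velField hG B 0‖₊ + K * Real.toNNReal (|r| + 1) with hL
  have hT : (0:ℝ) < 1 / (L + 1) := by positivity
  refine ⟨1 / (L + 1), hT, fun x₀ hx₀ => ?_⟩
  have hsub : Metric.closedBall x₀ ((1 : NNReal) : ℝ) ⊆ Metric.closedBall 0 (|r| + 1) := by
    refine Metric.closedBall_subset_closedBall' ?_
    rw [dist_zero_right, NNReal.coe_one]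
    linarith [le_abs_self r]
  have hPL : IsPicardLindelof (fun _ => velField hG B)
      (⟨0, left_mem_Icc.2 hT.le⟩ : Icc (0:ℝ) (1 / (L + 1))) x₀ 1 0 L K := by
    refine IsPicardLindelof.of_time_independent (fun x hx => ?_) (hK.mono hsub) ?_
    · have hx' := hsub hx
      have h0 : (0 : CurveSpace) ∈ Metric.closedBall (0 : CurveSpace) (|r| + 1) := by
        simp only [Metric.mem_closedBall, dist_self]
        positivity
      have h1 := hK.dist_le_mul x hx' 0 h0
      have h2 : ‖velField hG B x‖ ≤ ‖velField hG B 0‖ + dist (velField hG B x) (velField hG B 0) := by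
        rw [dist_eq_norm]
        exact norm_le_norm_add_norm_sub' _ _
      have h3 : (K : ℝ) * dist x 0 ≤ K * (|r| + 1) :=
        mul_le_mul_of_nonneg_left hx' K.2
      rw [hL, NNReal.coe_add, NNReal.coe_mul, coe_nnnorm, Real.coe_toNNReal _ (by positivity)]
      linarith
    · simp only [sub_zero, sub_self, NNReal.coe_one, NNReal.coe_zero, max_eq_left hT.le]
      rw [mul_one_div, div_le_one (by positivity)]
      linarith
  exact hPL.exists_eq_forall_mem_Icc_hasDerivWithinAt₀

/-- An integral curve of the velocity field starting at a closed curve consists of closed curves. -/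
theorem evalL_one_eq_of_hasDerivWithinAt (hG : ContDiff ℝ 2 G) {T R : ℝ} {x : ℝ → CurveSpace}
    (hx : ∀ t ∈ Icc 0 T, HasDerivWithinAt x (velField hG B (x t)) (Icc 0 T) t)
    (hR : ∀ t ∈ Icc 0 T, ‖x t‖ ≤ R) (h0 : evalL 0 (x 0) = evalL 1 (x 0)) :
    ∀ t ∈ Icc 0 T, evalL 0 (x t) = evalL 1 (x t) := by
  obtain ⟨K, hK⟩ := exists_inducedVel_param_sub_le hG B R
  have key := eq_zero_of_abs_deriv_le_mul_abs_self_of_eq_zero_right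
    (f := fun t => (evalL 0 - evalL 1) (x t))
    (f' := fun t => (evalL 0 - evalL 1) (velField hG B (x t))) (K := K) (a := 0) (b := T)
    ((evalL 0 - evalL 1).continuous.comp_continuousOn fun t ht => (hx t ht).continuousWithinAt)
    (fun t ht => (((evalL 0 - evalL 1).hasFDerivAt.comp_hasDerivWithinAt t
      (hx t (Ico_subset_Icc_self ht))).mono_of_mem_nhdsWithin (Icc_mem_nhdsGE_of_mem ht)))
    (by simp [h0]) (fun t ht => by
      rw [sub_apply, sub_apply,
        evalL_velField hG B _ (by simp), evalL_velField hG B _ (by simp)]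
      exact hK _ _ (isPrimitive_evalL (x t)) ((integral_norm_le_L2_norm _).trans
        ((norm_snd_le _).trans (hR t (Ico_subset_Icc_self ht)))) 0 (by simp) 1 (by simp))
  intro t ht
  simpa [sub_eq_zero] using key t ht

theorem exists_isTransported (hG : ContDiff ℝ 2 G) (B : E3 →L[ℝ] E3 →L[ℝ] E3) (r : ℝ) :
    ∃ T : ℝ, 0 < T ∧ ∀ γ₀ γ₀d : ℝ → E3, IsH1Loop γ₀ γ₀d →
      √(∫ ξ in Ioc (0:ℝ) 1, ‖γ₀ ξ‖ ^ 2) + √(∫ ξ in Ioc (0:ℝ) 1, ‖γ₀d ξ‖ ^ 2) ≤ r →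
      ∃ γ γd : ℝ → ℝ → E3, IsTransported G B γ₀ T γ γd := by
  obtain ⟨T, hT, hflow⟩ := exists_time_of_norm_le hG B r
  refine ⟨T, hT, fun γ₀ γ₀d hγ₀ hr => ?_⟩
  obtain ⟨x, hx0, hx⟩ := hflow (γ₀ 0, hγ₀.memL2.toLp) (by
    refine max_le (hγ₀.norm_zero_le.trans hr) ?_
    refine (L2_norm_toLp_eq_sqrt hγ₀.memL2).trans_le (le_trans ?_ hr)
    exact le_add_of_nonneg_left (Real.sqrt_nonneg _))
  have hxc : ContinuousOn x (Icc 0 T) := fun t ht => (hx t ht).continuousWithinAt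
  obtain ⟨R, hR⟩ := isCompact_Icc.exists_bound_of_continuousOn hxc
  obtain ⟨K, hK⟩ := exists_lipschitzOnWith_velField hG B R
  have hvc : ContinuousOn (fun t => velField hG B (x t)) (Icc 0 T) :=
    hK.continuousOn.comp hxc fun t ht => mem_closedBall_zero_iff.2 (hR t ht)
  obtain ⟨V, hV⟩ := isCompact_Icc.exists_bound_of_continuousOn hvc
  have hx_start : ∀ ξ ∈ Icc (0:ℝ) 1, evalL ξ (x 0) = γ₀ ξ := by
    intro ξ hξ
    rw [hx0, evalL_apply _ hξ, hγ₀.deriv_eq ξ hξ]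
    congr 1
    rw [intervalIntegral.integral_of_le hξ.1, intervalIntegral.integral_of_le hξ.1]
    exact integral_congr_ae (ae_restrict_of_ae_restrict_of_subset (Ioc_subset_Ioc_right hξ.2)
      hγ₀.memL2.coeFn_toLp)
  have hclosed := evalL_one_eq_of_hasDerivWithinAt hG hx hR
    (by rw [hx_start 0 (by simp), hx_start 1 (by simp), hγ₀.closed])
  refine ⟨fun t ξ => evalL ξ (x t), fun t => (x t).2, ⟨fun t ht => ?_, fun T' hT' => ?_,
    fun T' hT' => ?_, fun t ht => ?_⟩⟩
  · exact ⟨hclosed t (Ico_subset_Icc_self ht), (isPrimitive_evalL (x t)).eq_add, Lp.memLp (x t).2⟩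
  · refine ⟨R ^ 2, fun t ht => ?_⟩
    have h1 : ‖(x t).2‖ ≤ R := (norm_snd_le _).trans (hR t (Icc_subset_Icc_right hT'.2.le ht))
    rw [L2_norm_eq_sqrt] at h1
    exact (Real.sqrt_le_left ((Real.sqrt_nonneg _).trans h1)).1 h1
  · refine ⟨2 * V, fun s hs t ht => ?_⟩
    have hle : Icc 0 T' ⊆ Icc 0 T := Icc_subset_Icc_right hT'.2.le
    have h1 : ‖x t - x s‖ ≤ V * |t - s| :=
      (convex_Icc (0:ℝ) T).norm_image_sub_le_of_norm_hasDerivWithin_le hx hV (hle hs) (hle ht)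
    have h2 : 0 ≤ 2 * V * |t - s| := by linarith [norm_nonneg (x t - x s)]
    refine (Real.sqrt_le_left h2).2 ?_
    have h3 : ∀ ξ, ‖evalL ξ (x t) - evalL ξ (x s)‖ ^ 2 ≤ (2 * V * |t - s|) ^ 2 := fun ξ =>
      pow_le_pow_left₀ (norm_nonneg _) ((evalL_sub_norm_le _ _ ξ).trans (by linarith)) 2
    refine (integral_mono_of_nonneg (Filter.Eventually.of_forall fun ξ => by positivity)
      (integrable_const _) (Filter.Eventually.of_forall h3)).trans_eq ?_
    simp
  · refine (ae_restrict_iff' measurableSet_Ioc).2 (Filter.Eventually.of_forall fun ξ hξ => ?_)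
    have hξ' := Ioc_subset_Icc_self hξ
    have hle : Icc 0 t ⊆ Icc 0 T := Icc_subset_Icc_right ht.2.le
    have h1 := intervalIntegral.integral_eq_sub_of_hasDeriv_right_of_le ht.1
      (f := fun t => evalL ξ (x t)) (f' := fun t => evalL ξ (velField hG B (x t)))
      ((evalL ξ).continuous.comp_continuousOn (hxc.mono hle))
      (fun τ hτ => (((evalL ξ).hasFDerivAt.comp_hasDerivWithinAt τ
        (hx τ (hle (Ioo_subset_Icc_self hτ)))).mono_of_mem_nhdsWithin
          (Icc_mem_nhdsGE_of_mem ⟨hτ.1.le, hτ.2.trans ht.2⟩)).mono Ioi_subset_Ici_self)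
      (((evalL ξ).continuous.comp_continuousOn (hvc.mono hle)).intervalIntegrable_of_Icc ht.1)
    simp_rw [evalL_velField hG B _ hξ'] at h1
    rw [h1, hx_start ξ hξ']
    abel

end Existence

section Uniqueness

variable {G : E3 → E3} {B : E3 →L[ℝ] E3 →L[ℝ] E3}

/-- Interpolation between `L²` and `H¹`: the supremum norm of a curve is small when its `L²` norm
is small and its derivative is bounded in `L²`. -/
theorem IsPrimitive.norm_sq_le {d g : ℝ → E3} (h : IsPrimitive d g) (hg : MemLp g 2 unitVol)
    {δ N : ℝ} (hδ : 0 < δ) (hd : ∫ s, ‖d s‖ ^ 2 ∂unitVol ≤ δ ^ 2)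
    (hN : ∫ s, ‖g s‖ ^ 2 ∂unitVol ≤ N) {ξ : ℝ} (hξ : ξ ∈ Icc (0:ℝ) 1) :
    ‖d ξ‖ ^ 2 ≤ δ ^ 2 + δ * (1 + N) := by
  obtain ⟨C, hC⟩ := isCompact_Icc.exists_bound_of_continuousOn h.continuousOn
  have hdm : MemLp d 2 unitVol := MemLp.of_bound h.aestronglyMeasurable C
    ((ae_restrict_iff' measurableSet_Ioc).2
      (Filter.Eventually.of_forall fun ξ hξ => hC ξ (Ioc_subset_Icc_self hξ)))
  have i₁ : Integrable (fun s => ‖d s‖ ^ 2) unitVol := hdm.integrable_norm_pow (by norm_num)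
  have i₂ : Integrable (fun s => ‖g s‖ ^ 2) unitVol := hg.integrable_norm_pow (by norm_num)
  have hΦ : ContDiff ℝ 1 (fun z : E3 => ‖z‖ ^ 2) := contDiff_norm_sq ℝ
  have hfd : ∀ s, fderiv ℝ (fun z : E3 => ‖z‖ ^ 2) (d s) (g s) = 2 * inner ℝ (d s) (g s) := by
    intro s
    simp [fderiv_norm_sq_apply]
  have hle : ∀ s, ‖2 * inner ℝ (d s) (g s)‖ ≤ δ⁻¹ * ‖d s‖ ^ 2 + δ * ‖g s‖ ^ 2 := by
    intro s
    rw [norm_mul, Real.norm_ofNat]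
    have h1 := norm_inner_le_norm (𝕜 := ℝ) (d s) (g s)
    have h2 : 0 ≤ δ⁻¹ * (‖d s‖ - δ * ‖g s‖) ^ 2 := by positivity
    have h3 : δ⁻¹ * (‖d s‖ - δ * ‖g s‖) ^ 2 =
        δ⁻¹ * ‖d s‖ ^ 2 + δ * ‖g s‖ ^ 2 - 2 * (‖d s‖ * ‖g s‖) := by
      field_simp
      ring
    linarith
  have i₃ : Integrable (fun s => δ⁻¹ * ‖d s‖ ^ 2 + δ * ‖g s‖ ^ 2) unitVol :=
    (i₁.const_mul _).add (i₂.const_mul _)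
  have i₄ : Integrable (fun s => 2 * inner ℝ (d s) (g s)) unitVol :=
    i₃.mono' ((hdm.1.inner hg.1).const_mul 2) (Filter.Eventually.of_forall hle)
  have hI : ∫ s, ‖2 * inner ℝ (d s) (g s)‖ ∂unitVol ≤ δ * (1 + N) := by
    refine (integral_mono i₄.norm i₃ hle).trans ?_
    rw [integral_add (i₁.const_mul _) (i₂.const_mul _), integral_const_mul, integral_const_mul]
    have h1 : δ⁻¹ * ∫ s, ‖d s‖ ^ 2 ∂unitVol ≤ δ⁻¹ * δ ^ 2 := by gcongr
    have h2 : δ⁻¹ * δ ^ 2 = δ := by field_simp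
    have h3 : δ * ∫ s, ‖g s‖ ^ 2 ∂unitVol ≤ δ * N := by gcongr
    linarith
  have hpt : ∀ η ∈ Ioc (0:ℝ) 1, ‖d ξ‖ ^ 2 ≤ ‖d η‖ ^ 2 + δ * (1 + N) := by
    intro η hη
    have hη' := Ioc_subset_Icc_self hη
    have h0 : (0:ℝ) ∈ Icc (0:ℝ) 1 := by simp
    have e₁ := h.comp_eq hΦ hξ
    have e₂ := h.comp_eq hΦ hη'
    simp_rw [hfd] at e₁ e₂
    have e₃ := intervalIntegral.integral_interval_sub_left
      (intervalIntegrable_of_unitVol i₄ h0 hξ) (intervalIntegrable_of_unitVol i₄ h0 hη')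
    have e₄ := (le_abs_self _).trans (norm_intervalIntegral_le_unitVol i₄ hη' hξ)
    linarith
  have key : ∫ _η, ‖d ξ‖ ^ 2 ∂unitVol ≤ ∫ η, (‖d η‖ ^ 2 + δ * (1 + N)) ∂unitVol :=
    setIntegral_mono_on (integrable_const _) (i₁.add (integrable_const _)) measurableSet_Ioc hpt
  rw [integral_add i₁ (integrable_const _)] at key
  simp only [integral_const, probReal_univ, one_smul] at key
  linarith

open Classical in
/-- Restriction to the unit interval of a function continuous there, as a continuous map. -/
def restrictUnit (f : ℝ → E3) : C(Icc (0:ℝ) 1, E3) :=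
  if h : ContinuousOn f (Icc 0 1) then ⟨_, h.domRestrict⟩ else 0

theorem restrictUnit_apply {f : ℝ → E3} (hf : ContinuousOn f (Icc 0 1)) (ξ : Icc (0:ℝ) 1) :
    restrictUnit f ξ = f ξ := by
  simp [restrictUnit, hf]

theorem norm_restrictUnit_sub_le {f g : ℝ → E3} (hf : ContinuousOn f (Icc 0 1))
    (hg : ContinuousOn g (Icc 0 1)) {C : ℝ} (h : ∀ ξ ∈ Icc (0:ℝ) 1, ‖f ξ - g ξ‖ ≤ C) :
    ‖restrictUnit f - restrictUnit g‖ ≤ C := by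
  refine (ContinuousMap.norm_le _ ((norm_nonneg _).trans (h 0 (by simp)))).2 fun ξ => ?_
  rw [ContinuousMap.sub_apply, restrictUnit_apply hf, restrictUnit_apply hg]
  exact h ξ ξ.2

theorem norm_sub_le_norm_restrictUnit_sub {f g : ℝ → E3} (hf : ContinuousOn f (Icc 0 1))
    (hg : ContinuousOn g (Icc 0 1)) {ξ : ℝ} (hξ : ξ ∈ Icc (0:ℝ) 1) :
    ‖f ξ - g ξ‖ ≤ ‖restrictUnit f - restrictUnit g‖ := by
  have := ContinuousMap.norm_coe_le_norm (restrictUnit f - restrictUnit g) ⟨ξ, hξ⟩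
  rwa [ContinuousMap.sub_apply, restrictUnit_apply hf, restrictUnit_apply hg] at this

/-- A primitive that dominates its integrand vanishes. -/
theorem eq_zero_of_eq_integral_of_norm_le {X : Type*} [NormedAddCommGroup X] [NormedSpace ℝ X]
    [CompleteSpace X] {c v : ℝ → X} {T K : ℝ} (hv : ContinuousOn v (Icc 0 T))
    (hc : ∀ t ∈ Icc 0 T, c t = ∫ τ in (0:ℝ)..t, v τ)
    (hK : ∀ t ∈ Icc 0 T, ‖v t‖ ≤ K * ‖c t‖) : ∀ t ∈ Icc 0 T, c t = 0 := by
  intro t ht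
  have hT : 0 ≤ T := ht.1.trans ht.2
  set w : ℝ → X := IccExtend hT ((Icc 0 T).domRestrict v) with hw
  have hwc : Continuous w := hv.domRestrict.Icc_extend'
  have hwv : ∀ s ∈ Icc 0 T, w s = v s := fun s hs => IccExtend_of_mem hT _ hs
  have hcw : ∀ t ∈ Icc 0 T, c t = ∫ τ in (0:ℝ)..t, w τ := by
    intro t ht
    rw [hc t ht]
    refine intervalIntegral.integral_congr fun s hs => (hwv s ?_).symm
    rw [uIcc_of_le ht.1] at hs
    exact ⟨hs.1, hs.2.trans ht.2⟩
  have hd : ∀ t, HasDerivAt (fun u => ∫ τ in (0:ℝ)..u, w τ) (w t) t := fun t =>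
    (hwc.integral_hasStrictDerivAt 0 t).hasDerivAt
  rw [hcw t ht]
  refine eq_zero_of_abs_deriv_le_mul_abs_self_of_eq_zero_right (K := K)
    (fun t _ => (hd t).continuousAt.continuousWithinAt) (fun t _ => (hd t).hasDerivWithinAt)
    (by simp) (fun t ht => ?_) t ht
  have ht' := Ico_subset_Icc_self ht
  rw [hwv t ht', ← hcw t ht']
  exact hK t ht'

namespace IsTransported

variable {γ₀ : ℝ → E3} {Tstar T : ℝ} {γ γd : ℝ → ℝ → E3}

theorem exists_integral_norm_le (h : IsTransported G B γ₀ Tstar γ γd) (hT : T ∈ Ico 0 Tstar) :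
    ∃ M : ℝ, ∀ t ∈ Icc 0 T, ∫ s, ‖γd t s‖ ∂unitVol ≤ M := by
  obtain ⟨M, hM⟩ := h.bound T hT
  exact ⟨√M, fun t ht => (integral_norm_le_sqrt (h.loop t ⟨ht.1, ht.2.trans_lt hT.2⟩).memL2).trans
    (Real.sqrt_le_sqrt (hM t ht))⟩

theorem continuousOn_restrictUnit (h : IsTransported G B γ₀ Tstar γ γd) (hT : T ∈ Ico 0 Tstar) :
    ContinuousOn (fun t => restrictUnit (γ t)) (Icc 0 T) := by
  obtain ⟨M, hM⟩ := h.bound T hT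
  obtain ⟨K, hK⟩ := h.lipschitz T hT
  have hloop : ∀ t ∈ Icc 0 T, IsH1Loop (γ t) (γd t) := fun t ht =>
    h.loop t ⟨ht.1, ht.2.trans_lt hT.2⟩
  have hbd : ∀ s ∈ Icc 0 T, ∀ t ∈ Icc 0 T, t ≠ s → ‖restrictUnit (γ t) - restrictUnit (γ s)‖ ≤
      √(((|K| + 1) * |t - s|) ^ 2 + (|K| + 1) * |t - s| * (1 + 4 * M)) := by
    intro s hs t ht hne
    have hs' := hloop s hs
    have ht' := hloop t ht
    have hpos : 0 < |t - s| := abs_pos.2 (sub_ne_zero.2 hne)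
    refine norm_restrictUnit_sub_le ht'.isPrimitive.continuousOn hs'.isPrimitive.continuousOn
      fun ξ hξ => Real.le_sqrt_of_sq_le ?_
    refine (ht'.isPrimitive.sub hs'.isPrimitive).norm_sq_le (ht'.memL2.sub hs'.memL2)
      (by positivity) ?_ ?_ hξ
    · refine (Real.sqrt_le_left (by positivity)).1 ((hK s hs t ht).trans ?_)
      gcongr
      linarith [le_abs_self K]
    · have i₁ : Integrable (fun s => ‖γd t s‖ ^ 2) unitVol :=
        ht'.memL2.integrable_norm_pow (by norm_num)
      have i₂ : Integrable (fun ξ => ‖γd s ξ‖ ^ 2) unitVol :=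
        hs'.memL2.integrable_norm_pow (by norm_num)
      have h1 : ∫ ξ, ‖(γd t - γd s) ξ‖ ^ 2 ∂unitVol ≤
          ∫ ξ, (2 * ‖γd t ξ‖ ^ 2 + 2 * ‖γd s ξ‖ ^ 2) ∂unitVol := by
        refine integral_mono_of_nonneg (Filter.Eventually.of_forall fun ξ => by positivity)
          ((i₁.const_mul 2).add (i₂.const_mul 2)) (Filter.Eventually.of_forall fun ξ => ?_)
        have h2 : ‖γd t ξ - γd s ξ‖ ^ 2 ≤ (‖γd t ξ‖ + ‖γd s ξ‖) ^ 2 :=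
          pow_le_pow_left₀ (norm_nonneg _) (norm_sub_le _ _) 2
        simp only [Pi.sub_apply]
        nlinarith [sq_nonneg (‖γd t ξ‖ - ‖γd s ξ‖)]
      rw [integral_add (i₁.const_mul 2) (i₂.const_mul 2), integral_const_mul,
        integral_const_mul] at h1
      linarith [hM t ht, hM s hs]
  intro s hs
  rw [ContinuousWithinAt, tendsto_iff_norm_sub_tendsto_zero]
  have hlim : Filter.Tendsto
      (fun t => √(((|K| + 1) * |t - s|) ^ 2 + (|K| + 1) * |t - s| * (1 + 4 * M)))
      (nhdsWithin s (Icc 0 T)) (nhds 0) := by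
    have hcont : Continuous
        (fun t => √(((|K| + 1) * |t - s|) ^ 2 + (|K| + 1) * |t - s| * (1 + 4 * M))) := by
      fun_prop
    have := hcont.tendsto s
    simp only [sub_self, abs_zero, mul_zero, zero_mul, add_zero, ne_eq, OfNat.ofNat_ne_zero,
      not_false_eq_true, zero_pow, Real.sqrt_zero] at this
    exact this.mono_left nhdsWithin_le_nhds
  refine squeeze_zero' (Filter.Eventually.of_forall fun _ => norm_nonneg _) ?_ hlim
  filter_upwards [self_mem_nhdsWithin] with t ht
  rcases eq_or_ne t s with rfl | hne
  · simp
  · exact hbd s hs t ht hne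

theorem continuousOn_restrictUnit_inducedVel (h : IsTransported G B γ₀ Tstar γ γd)
    (hG : ContDiff ℝ 2 G) (hT : T ∈ Ico 0 Tstar) :
    ContinuousOn (fun t => restrictUnit (inducedVel G B (γ t) (γd t))) (Icc 0 T) := by
  obtain ⟨M, hM⟩ := h.exists_integral_norm_le hT
  obtain ⟨K, hK⟩ := exists_inducedVel_sub_le hG B M
  have hloop : ∀ t ∈ Icc 0 T, IsH1Loop (γ t) (γd t) := fun t ht =>
    h.loop t ⟨ht.1, ht.2.trans_lt hT.2⟩
  intro s hs
  have h2 := h.continuousOn_restrictUnit hT s hs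
  rw [ContinuousWithinAt, tendsto_iff_norm_sub_tendsto_zero] at h2 ⊢
  have h3 := h2.const_mul K
  rw [mul_zero] at h3
  refine squeeze_zero' (Filter.Eventually.of_forall fun _ => norm_nonneg _) ?_ h3
  filter_upwards [self_mem_nhdsWithin] with t ht
  have hs' := hloop s hs
  have ht' := hloop t ht
  exact norm_restrictUnit_sub_le (ht'.isPrimitive.continuousOn_inducedVel hG)
    (hs'.isPrimitive.continuousOn_inducedVel hG)
    (hK _ _ _ _ ht'.isPrimitive ht'.closed hs'.isPrimitive hs'.closed (hM t ht) (hM s hs) _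
      fun η hη => norm_sub_le_norm_restrictUnit_sub ht'.isPrimitive.continuousOn
        hs'.isPrimitive.continuousOn hη)

theorem restrictUnit_eq (h : IsTransported G B γ₀ Tstar γ γd) (hG : ContDiff ℝ 2 G)
    (hγ₀ : ContinuousOn γ₀ (Icc 0 1)) {t : ℝ} (ht : t ∈ Ico 0 Tstar) :
    restrictUnit (γ t) = restrictUnit γ₀ +
      ∫ τ in (0:ℝ)..t, restrictUnit (inducedVel G B (γ τ) (γd τ)) := by
  have hV_integrable : IntervalIntegrable (fun τ => restrictUnit (inducedVel G B (γ τ) (γd τ))) volume 0 t :=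
    (h.continuousOn_restrictUnit_inducedVel hG ht).intervalIntegrable_of_Icc ht.1
  have hγt := (h.loop t ht).isPrimitive.continuousOn
  set I := ∫ τ in (0:ℝ)..t, restrictUnit (inducedVel G B (γ τ) (γd τ)) with hI
  have hev : ∀ ξ : Icc (0:ℝ) 1, I ξ = ∫ τ in (0:ℝ)..t, inducedVel G B (γ τ) (γd τ) ξ := by
    intro ξ
    have h1 := (ContinuousMap.evalCLM ℝ ξ : C(Icc (0:ℝ) 1, E3) →L[ℝ] E3).intervalIntegral_comp_comm
      hV_integrable
    refine h1.symm.trans (intervalIntegral.integral_congr fun τ hτ => ?_)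
    rw [uIcc_of_le ht.1] at hτ
    exact restrictUnit_apply ((h.loop τ ⟨hτ.1, hτ.2.trans_lt ht.2⟩).isPrimitive.continuousOn_inducedVel
      hG) ξ
  have key : EqOn (γ t) (fun ξ => γ₀ ξ + I (projIcc 0 1 zero_le_one ξ)) (Icc 0 1) := by
    refine Measure.eqOn_Icc_of_ae_eq volume zero_ne_one ?_ hγt
      (hγ₀.add (I.continuous.comp continuous_projIcc).continuousOn)
    rw [restrict_Ioc_eq_restrict_Icc.symm]
    filter_upwards [h.eq_integral t ht, ae_restrict_mem measurableSet_Ioc] with ξ hξ hmem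
    rw [hξ, projIcc_of_mem zero_le_one (Ioc_subset_Icc_self hmem), hev]
  ext1 ξ
  rw [ContinuousMap.add_apply, restrictUnit_apply hγt, restrictUnit_apply hγ₀, key ξ.2]
  simp

theorem unique (hG : ContDiff ℝ 2 G) (hγ₀ : ContinuousOn γ₀ (Icc 0 1)) {γ₁ γd₁ γ₂ γd₂ : ℝ → ℝ → E3}
    (h₁ : IsTransported G B γ₀ Tstar γ₁ γd₁) (h₂ : IsTransported G B γ₀ Tstar γ₂ γd₂) {t : ℝ}
    (ht : t ∈ Ico 0 Tstar) {ξ : ℝ} (hξ : ξ ∈ Icc (0:ℝ) 1) : γ₁ t ξ = γ₂ t ξ := by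
  obtain ⟨M₁, hM₁⟩ := h₁.exists_integral_norm_le ht
  obtain ⟨M₂, hM₂⟩ := h₂.exists_integral_norm_le ht
  obtain ⟨K, hK⟩ := exists_inducedVel_sub_le hG B (max M₁ M₂)
  have hmem : ∀ s ∈ Icc 0 t, s ∈ Ico 0 Tstar := fun s hs => ⟨hs.1, hs.2.trans_lt ht.2⟩
  have hc₁ := h₁.continuousOn_restrictUnit_inducedVel hG ht
  have hc₂ := h₂.continuousOn_restrictUnit_inducedVel hG ht
  have key := eq_zero_of_eq_integral_of_norm_le (K := K)
    (c := fun s => restrictUnit (γ₁ s) - restrictUnit (γ₂ s))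
    (v := fun s => restrictUnit (inducedVel G B (γ₁ s) (γd₁ s)) -
      restrictUnit (inducedVel G B (γ₂ s) (γd₂ s))) (hc₁.sub hc₂)
    (fun s hs => by
      have hsub : Icc 0 s ⊆ Icc 0 t := Icc_subset_Icc_right hs.2
      rw [intervalIntegral.integral_sub ((hc₁.mono hsub).intervalIntegrable_of_Icc hs.1)
        ((hc₂.mono hsub).intervalIntegrable_of_Icc hs.1), h₁.restrictUnit_eq hG hγ₀ (hmem s hs),
        h₂.restrictUnit_eq hG hγ₀ (hmem s hs), add_sub_add_left_eq_sub])
    (fun s hs => by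
      have hl₁ := h₁.loop s (hmem s hs)
      have hl₂ := h₂.loop s (hmem s hs)
      exact norm_restrictUnit_sub_le (hl₁.isPrimitive.continuousOn_inducedVel hG)
        (hl₂.isPrimitive.continuousOn_inducedVel hG)
        (hK _ _ _ _ hl₁.isPrimitive hl₁.closed hl₂.isPrimitive hl₂.closed
          ((hM₁ s hs).trans (le_max_left _ _)) ((hM₂ s hs).trans (le_max_right _ _)) _
          fun η hη => norm_sub_le_norm_restrictUnit_sub hl₁.isPrimitive.continuousOn
            hl₂.isPrimitive.continuousOn hη))
    t (right_mem_Icc.2 ht.1)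
  have hle := norm_sub_le_norm_restrictUnit_sub (h₁.loop t ht).isPrimitive.continuousOn
    (h₂.loop t ht).isPrimitive.continuousOn hξ
  rw [key, norm_zero] at hle
  exact sub_eq_zero.1 (norm_le_zero_iff.1 hle)

end IsTransported

end Uniqueness

section Rosenhead

/-- The cross product as a continuous bilinear map. -/
def crossCLM : E3 →L[ℝ] E3 →L[ℝ] E3 :=
  LinearMap.toContinuousBilinearMap (LinearMap.mk₂ ℝ cross3
    (fun a b c => by simp [cross3]) (fun r a b => by simp [cross3])
    (fun a b c => by simp [cross3]) (fun r a b => by simp [cross3]))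

theorem crossCLM_apply (a b : E3) : crossCLM a b = cross3 a b := rfl

/-- The Rosenhead kernel. -/
def rosenheadKernel (μ : ℝ) (z : E3) : E3 := (‖z‖ ^ 2 + μ ^ 2) ^ (-(3:ℝ) / 2) • z

theorem contDiff_rosenheadKernel {μ : ℝ} (hμ : 0 < μ) : ContDiff ℝ 2 (rosenheadKernel μ) :=
  (((contDiff_norm_sq ℝ).add contDiff_const).rpow_const_of_ne fun z => by positivity).smul
    contDiff_id

theorem inducedVel_rosenheadKernel (Γ μ : ℝ) (γ g : ℝ → E3) (ξ : ℝ) :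
    inducedVel (rosenheadKernel μ) (-(Γ / (4 * π)) • crossCLM) γ g ξ =
      -(Γ / (4 * π)) • ∫ η in (0:ℝ)..1, ((‖γ ξ - γ η‖ ^ 2 + μ ^ 2) ^ (-(3:ℝ) / 2)) •
        cross3 (γ ξ - γ η) (g η) := by
  rw [intervalIntegral.integral_of_le zero_le_one, ← integral_smul]
  refine integral_congr_ae (Filter.Eventually.of_forall fun η => ?_)
  simp only [rosenheadKernel, map_smul, smul_apply, crossCLM_apply]
  exact smul_comm _ _ _

theorem isRosenheadSolution_iff {Γ μ : ℝ} {γ₀ : ℝ → E3} {Tstar : ℝ} {γ : ℝ → ℝ → E3} :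
    IsRosenheadSolution Γ μ γ₀ Tstar γ ↔ ∃ γd : ℝ → ℝ → E3,
      IsTransported (rosenheadKernel μ) (-(Γ / (4 * π)) • crossCLM) γ₀ Tstar γ γd := by
  have e : ∀ (γd : ℝ → ℝ → E3) (t ξ : ℝ),
      ∫ τ in (0:ℝ)..t, inducedVel (rosenheadKernel μ) (-(Γ / (4 * π)) • crossCLM) (γ τ) (γd τ) ξ =
        -((Γ / (4 * π)) • ∫ τ in (0:ℝ)..t, ∫ η in (0:ℝ)..1,
          ((‖γ τ ξ - γ τ η‖ ^ 2 + μ ^ 2) ^ (-(3:ℝ) / 2)) •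
            cross3 (γ τ ξ - γ τ η) (γd τ η)) := by
    intro γd t ξ
    simp_rw [inducedVel_rosenheadKernel]
    rw [intervalIntegral.integral_smul, neg_smul]
  refine exists_congr fun γd => ⟨fun ⟨h₁, h₂, h₃, h₄⟩ => ⟨h₁, h₂, h₃, ?_⟩,
    fun ⟨h₁, h₂, h₃, h₄⟩ => ⟨h₁, h₂, h₃, ?_⟩⟩
  all_goals simpa only [e, sub_eq_add_neg] using h₄

end Rosenhead

/-- Local existence and uniqueness for the Rosenhead regularized vortex filament
equation, with a strictly positive lower bound on the existence time depending only
on `‖γ₀‖_{L²} + ‖γ₀'‖_{L²}`. -/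
theorem rosenhead_local_existence_uniqueness (Γ μ : ℝ) (hΓ : 0 < Γ) (hμ : 0 < μ) :
    ∃ f : ℝ → ℝ, (∀ r : ℝ, 0 < f r) ∧
      ∀ γ₀ γ₀d : ℝ → E3, IsH1Loop γ₀ γ₀d →
        ∃ Tstar : ℝ, 0 < Tstar ∧
          f (Real.sqrt (∫ ξ in Ioc (0:ℝ) 1, ‖γ₀ ξ‖ ^ 2) +
              Real.sqrt (∫ ξ in Ioc (0:ℝ) 1, ‖γ₀d ξ‖ ^ 2)) ≤ Tstar ∧
          ∃ γ : ℝ → ℝ → E3, IsRosenheadSolution Γ μ γ₀ Tstar γ ∧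
            ∀ γ' : ℝ → ℝ → E3, IsRosenheadSolution Γ μ γ₀ Tstar γ' →
              ∀ t ∈ Ico (0:ℝ) Tstar, ∀ ξ ∈ Icc (0:ℝ) 1, γ' t ξ = γ t ξ := by
  have hG := contDiff_rosenheadKernel hμ
  choose f hf hsol using exists_isTransported hG (-(Γ / (4 * π)) • crossCLM)
  refine ⟨f, hf, fun γ₀ γ₀d hγ₀ => ⟨_, hf _, le_rfl, ?_⟩⟩
  obtain ⟨γ, γd, hγ⟩ := hsol _ γ₀ γ₀d hγ₀ le_rfl
  refine ⟨γ, isRosenheadSolution_iff.2 ⟨γd, hγ⟩, fun γ' hγ' t ht ξ hξ => ?_⟩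
  obtain ⟨γd', h'⟩ := isRosenheadSolution_iff.1 hγ'
  exact h'.unique hG hγ₀.isPrimitive.continuousOn hγ ht hξ
end
end

section
/- In the periodic vortex loop setting, the velocity field u built from any configuration (x_α, m_α)_{α=1,…,N} is twice continuously differentiable and satisfies sup_{x} |u(x)| + sup_{x} ‖Du(x)‖ + sup_{x} ‖D²u(x)‖ ≤ C (∑_{k∈ℤ³} (1+|k|²)² ρ̂(k))^{1/2} H^{1/2}, where C is an absolute constant (independent of N, ρ̂, and the configuration). -/
noncomputable section
open MeasureTheory Real Set

/-- `ℂ³` with the Hermitian inner product. -/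
abbrev C3 := EuclideanSpace ℂ (Fin 3)

/-- A wave number `k ∈ ℤ³` viewed as a vector of `ℂ³`. -/
def kC (k : Fin 3 → ℤ) : C3 := WithLp.toLp 2 (fun i => (k i : ℂ))

/-- A wave number `k ∈ ℤ³` viewed as a vector of `ℝ³`. -/
def kR (k : Fin 3 → ℤ) : E3 := WithLp.toLp 2 (fun i => (k i : ℝ))

/-- A real vector viewed as a vector of `ℂ³`. -/
def toC3 (m : E3) : C3 := WithLp.toLp 2 (fun i => (m i : ℂ))

/-- For `k ≠ 0`, the orthogonal projection of `ℂ³` onto the orthogonal complement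
of `k`; the identity for `k = 0`. -/
def projPerp (k : Fin 3 → ℤ) (v : C3) : C3 :=
  if k = 0 then v
  else v - ((inner ℂ (kC k) v : ℂ) / ((‖kR k‖ ^ 2 : ℝ) : ℂ)) • kC k

/-- The (complex form of the) velocity field
`u(x) = (2π)⁻³ ∑_{k∈ℤ³} ρ̂(k) Π_k (∑_α m_α e^{-i⟨k, x−x_α⟩})`. -/
def loopVelC (N : ℕ) (ρh : (Fin 3 → ℤ) → ℝ) (x m : Fin N → E3) (p : E3) : C3 :=
  ((2 * π : ℝ) ^ 3)⁻¹ •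
    ∑' k : Fin 3 → ℤ, (ρh k : ℂ) •
      projPerp k (∑ α, Complex.exp (-Complex.I * ((inner ℝ (kR k) (p - x α) : ℝ) : ℂ)) • toC3 (m α))

/-- The velocity field of the periodic vortex loop configuration `(x_α, m_α)`,
a real vector field by the symmetry of `ρ̂`. -/
def loopVel (N : ℕ) (ρh : (Fin 3 → ℤ) → ℝ) (x m : Fin N → E3) (p : E3) : E3 :=
  WithLp.toLp 2 (fun i => (loopVelC N ρh x m p i).re)

/-- The energy `H = (1/(2(2π)³)) ∑_{k∈ℤ³} ρ̂(k) |Π_k ∑_α m_α e^{i⟨k,x_α⟩}|²`. -/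
def loopEnergy (N : ℕ) (ρh : (Fin 3 → ℤ) → ℝ) (x m : Fin N → E3) : ℝ :=
  (1 / (2 * (2 * π) ^ 3)) *
    ∑' k : Fin 3 → ℤ, ρh k *
      ‖projPerp k (∑ α, Complex.exp (Complex.I * ((inner ℝ (kR k) (x α) : ℝ) : ℂ)) • toC3 (m α))‖ ^ 2

theorem projPerp_smul (k : Fin 3 → ℤ) (c : ℂ) (v : C3) :
    projPerp k (c • v) = c • projPerp k v := by
  unfold projPerp
  split_ifs
  · rfl
  · rw [inner_smul_right, smul_sub, smul_smul, mul_div_assoc]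

theorem norm_kC (k : Fin 3 → ℤ) : ‖kC k‖ = ‖kR k‖ := by
  simp [kC, kR, EuclideanSpace.norm_eq]

theorem norm_projPerp_le (k : Fin 3 → ℤ) (v : C3) : ‖projPerp k v‖ ≤ 2 * ‖v‖ := by
  unfold projPerp
  split_ifs
  · linarith [norm_nonneg v]
  · have h : ‖((inner ℂ (kC k) v : ℂ) / ((‖kR k‖ ^ 2 : ℝ) : ℂ)) • kC k‖ ≤ ‖v‖ := by
      rw [norm_smul, norm_div, Complex.norm_real, norm_kC, Real.norm_of_nonneg (by positivity)]
      have hi : ‖(inner ℂ (kC k) v : ℂ)‖ ≤ ‖kR k‖ * ‖v‖ := by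
        simpa [norm_kC] using norm_inner_le_norm (𝕜 := ℂ) (kC k) v
      rcases (norm_nonneg (kR k)).eq_or_lt with h0 | h0
      · simp [← h0]
      · rw [div_mul_eq_mul_div, div_le_iff₀ (by positivity)]
        nlinarith
    linarith [norm_sub_le v (((inner ℂ (kC k) v : ℂ) / ((‖kR k‖ ^ 2 : ℝ) : ℂ)) • kC k)]

/-- The `k`-th mode `Π_k ∑_α m_α e^{i⟨k,x_α⟩}` of a configuration. -/
def loopMode {N : ℕ} (x m : Fin N → E3) (k : Fin 3 → ℤ) : C3 :=
  projPerp k (∑ α, Complex.exp (Complex.I * ((inner ℝ (kR k) (x α) : ℝ) : ℂ)) • toC3 (m α))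

theorem norm_loopMode_le {N : ℕ} (x m : Fin N → E3) (k : Fin 3 → ℤ) :
    ‖loopMode x m k‖ ≤ 2 * ∑ α, ‖toC3 (m α)‖ := by
  refine (norm_projPerp_le _ _).trans ?_
  gcongr
  refine (norm_sum_le _ _).trans (Finset.sum_le_sum fun α _ => ?_)
  rw [norm_smul, Complex.norm_exp_I_mul_ofReal, one_mul]

/-- The plane wave `p ↦ e^{-i⟨k,p⟩} c`. -/
def planeWave (k : Fin 3 → ℤ) (c : C3) (p : E3) : C3 :=
  Complex.exp (-Complex.I * ((inner ℝ (kR k) p : ℝ) : ℂ)) • c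

theorem loopVelC_eq_tsum_planeWave (N : ℕ) (ρh : (Fin 3 → ℤ) → ℝ) (x m : Fin N → E3) :
    loopVelC N ρh x m = fun p => ((2 * π : ℝ) ^ 3)⁻¹ •
      ∑' k : Fin 3 → ℤ, planeWave k ((ρh k : ℂ) • loopMode x m k) p := by
  funext p
  unfold loopVelC
  congr 2
  funext k
  rw [planeWave, smul_comm _ (ρh k : ℂ), loopMode]
  congr 1
  rw [← projPerp_smul, Finset.smul_sum]
  congr 2
  funext α
  rw [smul_smul, ← Complex.exp_add, inner_sub_right]
  congr 2
  push_cast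
  ring

theorem iteratedDeriv_cexp_neg_I_mul_smul (n : ℕ) (c : C3) :
    iteratedDeriv n (fun t : ℝ => Complex.exp (-Complex.I * t) • c) =
      fun t : ℝ => ((-Complex.I) ^ n * Complex.exp (-Complex.I * t)) • c := by
  induction n with
  | zero => simp
  | succ n ih =>
    rw [iteratedDeriv_succ, ih]
    funext t
    have h : HasDerivAt (fun t : ℝ => -Complex.I * (t : ℂ)) (-Complex.I) t := by
      simpa using (Complex.ofRealCLM.hasDerivAt (x := t)).const_mul (-Complex.I)
    rw [((h.cexp.const_mul ((-Complex.I) ^ n)).smul_const c).deriv]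
    congr 1
    ring

theorem contDiff_cexp_neg_I_mul_smul {n : WithTop ℕ∞} (c : C3) :
    ContDiff ℝ n (fun t : ℝ => Complex.exp (-Complex.I * t) • c) :=
  ((contDiff_const.mul Complex.ofRealCLM.contDiff).cexp).smul contDiff_const

theorem planeWave_eq_comp (k : Fin 3 → ℤ) (c : C3) :
    planeWave k c = (fun t : ℝ => Complex.exp (-Complex.I * t) • c) ∘ innerSL ℝ (kR k) := rfl

theorem contDiff_planeWave {n : WithTop ℕ∞} (k : Fin 3 → ℤ) (c : C3) :
    ContDiff ℝ n (planeWave k c) := by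
  rw [planeWave_eq_comp]
  exact (contDiff_cexp_neg_I_mul_smul c).comp (innerSL ℝ (kR k)).contDiff

theorem norm_iteratedFDeriv_planeWave_le (n : ℕ) (k : Fin 3 → ℤ) (c : C3) (p : E3) :
    ‖iteratedFDeriv ℝ n (planeWave k c) p‖ ≤ ‖kR k‖ ^ n * ‖c‖ := by
  rw [planeWave_eq_comp, ContinuousLinearMap.iteratedFDeriv_comp_right _
    (contDiff_cexp_neg_I_mul_smul (n := n) c) _ le_rfl]
  refine (ContinuousMultilinearMap.norm_compContinuousLinearMap_le _ _).trans_eq ?_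
  rw [norm_iteratedFDeriv_eq_norm_iteratedDeriv, iteratedDeriv_cexp_neg_I_mul_smul, norm_smul,
    norm_mul, norm_pow, norm_neg, Complex.norm_I, one_pow, one_mul, Complex.norm_exp]
  simp [mul_comm]

/-- The coordinatewise real part `ℂ³ → ℝ³`. -/
def reC3 : C3 →L[ℝ] E3 :=
  LinearMap.mkContinuous
    { toFun := fun v => WithLp.toLp 2 (fun i => (v i).re)
      map_add' := fun v w => by ext i; simp
      map_smul' := fun c v => by ext i; simp } 1 fun v => by
    rw [one_mul, EuclideanSpace.norm_eq, EuclideanSpace.norm_eq]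
    gcongr with i
    exact Complex.abs_re_le_norm _

theorem norm_reC3_le : ‖reC3‖ ≤ 1 := LinearMap.mkContinuous_norm_le _ zero_le_one _

theorem loopVel_eq_reC3_comp (N : ℕ) (ρh : (Fin 3 → ℤ) → ℝ) (x m : Fin N → E3) :
    loopVel N ρh x m = (((2 * π : ℝ) ^ 3)⁻¹ • reC3) ∘
      fun p => ∑' k : Fin 3 → ℤ, planeWave k ((ρh k : ℂ) • loopMode x m k) p := by
  have h : loopVel N ρh x m = reC3 ∘ loopVelC N ρh x m := rfl
  rw [h, loopVelC_eq_tsum_planeWave]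
  funext p
  simp

/-- A weighted Cauchy–Schwarz inequality for series. -/
theorem summable_and_tsum_mul_mul_le_sqrt_mul_sqrt {ι : Type*} {w a ρ : ι → ℝ}
    (hw : ∀ i, 0 ≤ w i) (ha : ∀ i, 0 ≤ a i) (hρ : ∀ i, 0 ≤ ρ i)
    (hws : Summable fun i => w i ^ 2 * ρ i) (has : Summable fun i => ρ i * a i ^ 2) :
    (Summable fun i => w i * (ρ i * a i)) ∧
      ∑' i, w i * (ρ i * a i) ≤ √(∑' i, w i ^ 2 * ρ i) * √(∑' i, ρ i * a i ^ 2) := by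
  have e₁ : ∀ i, (w i * √(ρ i)) ^ (2 : ℝ) = w i ^ 2 * ρ i := fun i => by
    rw [Real.rpow_two, mul_pow, Real.sq_sqrt (hρ i)]
  have e₂ : ∀ i, (√(ρ i) * a i) ^ (2 : ℝ) = ρ i * a i ^ 2 := fun i => by
    rw [Real.rpow_two, mul_pow, Real.sq_sqrt (hρ i)]
  have e₃ : ∀ i, (w i * √(ρ i)) * (√(ρ i) * a i) = w i * (ρ i * a i) := fun i => by
    linear_combination w i * a i * Real.mul_self_sqrt (hρ i)
  have h := Real.summable_and_inner_le_Lp_mul_Lq_tsum_of_nonneg Real.HolderConjugate.two_two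
    (f := fun i => w i * √(ρ i)) (g := fun i => √(ρ i) * a i)
    (fun i => mul_nonneg (hw i) (Real.sqrt_nonneg _))
    (fun i => mul_nonneg (Real.sqrt_nonneg _) (ha i)) (by simpa only [e₁]) (by simpa only [e₂])
  simpa only [e₁, e₂, e₃, ← Real.sqrt_eq_rpow] using h

theorem pow_le_one_add_sq (r : ℝ) {n : ℕ} (hn : n ≤ 2) : r ^ n ≤ 1 + r ^ 2 := by
  interval_cases n <;> nlinarith [sq_nonneg (r - 1)]

/-- A series of plane waves with `∑ (1+|k|²) |c_k| < ∞` is `C²`, with derivatives up to order two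
bounded by that sum. -/
theorem contDiff_tsum_planeWave_and_norm_iteratedFDeriv_le {c : (Fin 3 → ℤ) → C3}
    (hc : Summable fun k => (1 + ‖kR k‖ ^ 2) * ‖c k‖) :
    ContDiff ℝ 2 (fun p => ∑' k, planeWave k (c k) p) ∧
      ∀ n ≤ 2, ∀ p, ‖iteratedFDeriv ℝ n (fun p => ∑' k, planeWave k (c k) p) p‖ ≤
        ∑' k, (1 + ‖kR k‖ ^ 2) * ‖c k‖ := by
  have hb : ∀ (n : ℕ) (k : Fin 3 → ℤ) (p : E3), (n : ℕ∞) ≤ (2 : ℕ∞) →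
      ‖iteratedFDeriv ℝ n (planeWave k (c k)) p‖ ≤ (1 + ‖kR k‖ ^ 2) * ‖c k‖ :=
    fun n k p hn => (norm_iteratedFDeriv_planeWave_le n k (c k) p).trans
      (mul_le_mul_of_nonneg_right (pow_le_one_add_sq _ (by exact_mod_cast hn))
        (norm_nonneg _))
  refine ⟨contDiff_tsum (N := 2) (v := fun _ k => (1 + ‖kR k‖ ^ 2) * ‖c k‖)
    (fun k => contDiff_planeWave k (c k)) (fun _ _ => hc) hb, fun n hn p => ?_⟩
  have hn_le : (n : ℕ∞) ≤ 2 := by exact_mod_cast hn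
  rw [iteratedFDeriv_tsum_apply (N := 2) (v := fun _ k => (1 + ‖kR k‖ ^ 2) * ‖c k‖)
    (fun k => contDiff_planeWave k (c k)) (fun _ _ => hc) hb hn_le]
  exact tsum_of_norm_bounded hc.hasSum fun k => hb n k p hn_le

/-- The periodic vortex loop velocity field is `C²` and bounded, together with its
first and second derivatives, by an absolute constant times
`(∑_k (1+|k|²)² ρ̂(k))^{1/2} H^{1/2}`. -/
theorem loopVel_bound :
    ∃ C : ℝ, 0 < C ∧
      ∀ (N : ℕ) (hN : 0 < N) (ρh : (Fin 3 → ℤ) → ℝ),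
        (∀ k, 0 ≤ ρh k) → (∀ k, ρh (-k) = ρh k) →
        Summable (fun k : Fin 3 → ℤ => (1 + ‖kR k‖ ^ 2) ^ 2 * ρh k) →
        ∀ x m : Fin N → E3,
          ContDiff ℝ 2 (loopVel N ρh x m) ∧
          (⨆ p : E3, ‖loopVel N ρh x m p‖) +
            (⨆ p : E3, ‖iteratedFDeriv ℝ 1 (loopVel N ρh x m) p‖) +
            (⨆ p : E3, ‖iteratedFDeriv ℝ 2 (loopVel N ρh x m) p‖) ≤
          C * Real.sqrt (∑' k : Fin 3 → ℤ, (1 + ‖kR k‖ ^ 2) ^ 2 * ρh k) *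
            Real.sqrt (loopEnergy N ρh x m) := by
  refine ⟨3 * (((2 * π) ^ 3)⁻¹ * √(2 * (2 * π) ^ 3)), by positivity, ?_⟩
  intro N _ ρh hρ _ hs x m
  have hmode : Summable fun k => ρh k * ‖loopMode x m k‖ ^ 2 := by
    refine Summable.of_nonneg_of_le (fun k => mul_nonneg (hρ k) (sq_nonneg _)) (fun k => ?_)
      (hs.mul_right ((2 * ∑ α, ‖toC3 (m α)‖) ^ 2))
    refine mul_le_mul (le_mul_of_one_le_left (hρ k) ?_)
      (pow_le_pow_left₀ (norm_nonneg _) (norm_loopMode_le x m k) 2) (sq_nonneg _)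
      (mul_nonneg (sq_nonneg _) (hρ k))
    exact one_le_pow₀ (le_add_of_nonneg_right (sq_nonneg _))
  have hH : ∑' k, ρh k * ‖loopMode x m k‖ ^ 2 = 2 * (2 * π) ^ 3 * loopEnergy N ρh x m := by
    simp only [loopEnergy, loopMode]
    field_simp
  obtain ⟨hsum, hle⟩ := summable_and_tsum_mul_mul_le_sqrt_mul_sqrt
    (w := fun k => 1 + ‖kR k‖ ^ 2) (fun k => by positivity) (fun k => norm_nonneg _) hρ hs hmode
  have hnorm : ∀ k, ‖(ρh k : ℂ) • loopMode x m k‖ = ρh k * ‖loopMode x m k‖ := fun k => by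
    rw [norm_smul, Complex.norm_real, Real.norm_of_nonneg (hρ k)]
  obtain ⟨hcd, hbd⟩ := contDiff_tsum_planeWave_and_norm_iteratedFDeriv_le
    (c := fun k => (ρh k : ℂ) • loopMode x m k) (by simpa only [hnorm] using hsum)
  have hvel := loopVel_eq_reC3_comp N ρh x m
  rw [hH, Real.sqrt_mul (by positivity)] at hle
  simp only [hnorm] at hbd
  set S := √(∑' k : Fin 3 → ℤ, (1 + ‖kR k‖ ^ 2) ^ 2 * ρh k)
  have hL : ‖((2 * π : ℝ) ^ 3)⁻¹ • reC3‖ ≤ ((2 * π) ^ 3)⁻¹ := by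
    rw [norm_smul, Real.norm_of_nonneg (by positivity)]
    exact mul_le_of_le_one_right (by positivity) norm_reC3_le
  have hder : ∀ n ≤ 2, ∀ p, ‖iteratedFDeriv ℝ n (loopVel N ρh x m) p‖ ≤
      ((2 * π) ^ 3)⁻¹ * (S * (√(2 * (2 * π) ^ 3) * √(loopEnergy N ρh x m))) := by
    intro n hn p
    rw [hvel]
    refine (ContinuousLinearMap.norm_iteratedFDeriv_comp_left _ hcd.contDiffAt
      (by exact_mod_cast hn)).trans ?_
    exact mul_le_mul hL ((hbd n hn p).trans hle) (norm_nonneg _) (by positivity)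
  refine ⟨hvel ▸ (ContinuousLinearMap.contDiff _).comp hcd, ?_⟩
  have h₀ := ciSup_le fun p => (norm_iteratedFDeriv_zero (𝕜 := ℝ)).symm.le.trans
    (hder 0 (by norm_num) p)
  have h₁ := ciSup_le (hder 1 (by norm_num))
  have h₂ := ciSup_le (hder 2 le_rfl)
  refine (add_le_add (add_le_add h₀ h₁) h₂).trans_eq ?_
  ring
end
end

section
/- In the periodic vortex loop setting, the energy is conserved along solutions: if (x_α(t), m_α(t))_{α=1,…,N} is a continuously differentiable solution of the loop system ẋ_α(t) = u_t(x_α(t)), ṁ_α^i(t) = −∑_{j=1}^3 m_α^j(t) ∂_i u_t^j(x_α(t)) on an interval [0,T], then t ↦ H(x_α(t), m_α(t)) is constant on [0,T]. -/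
noncomputable section
open MeasureTheory Real Set

/-- `(x_α(t), m_α(t))` solves the vortex loop system
`ẋ_α = u_t(x_α)`, `ṁ_α^i = −∑_j m_α^j ∂_i u_t^j(x_α)` at every time of `S`. -/
def IsLoopSystemSolution (N : ℕ) (ρh : (Fin 3 → ℤ) → ℝ)
    (x m : Fin N → ℝ → E3) (S : Set ℝ) : Prop :=
  ∀ t ∈ S, ∀ α : Fin N,
    HasDerivAt (x α) (loopVel N ρh (fun β => x β t) (fun β => m β t) (x α t)) t ∧
    ∀ i : Fin 3,
      HasDerivAt (fun s => m α s i)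
        (-∑ j : Fin 3, m α t j *
          fderiv ℝ (loopVel N ρh (fun β => x β t) (fun β => m β t)) (x α t)
            (EuclideanSpace.single i 1) j) t

open scoped InnerProductSpace

section PairInteraction

variable {E ι : Type*} [NormedAddCommGroup E] [InnerProductSpace ℝ E] [Fintype ι]

lemma fderiv_neg_of_even {F : Type*} [NormedAddCommGroup F] [NormedSpace ℝ F] {f : E → F}
    (hf : Differentiable ℝ f) (heven : ∀ p, f (-p) = f p) (p : E) :
    fderiv ℝ f (-p) = -fderiv ℝ f p := by
  have h : HasFDerivAt (fun q => f (-q)) ((fderiv ℝ f (-p)).comp (-ContinuousLinearMap.id ℝ E)) p :=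
    (hf (-p)).hasFDerivAt.comp p (hasFDerivAt_id p).neg
  have h' := h.unique (by simpa only [heven] using (hf p).hasFDerivAt)
  rw [← h']
  ext v
  simp

lemma inner_fderiv_apply_comm {K : E → E →L[ℝ] E} (hK : Differentiable ℝ K)
    (hsymm : ∀ p a b, ⟪K p a, b⟫_ℝ = ⟪a, K p b⟫_ℝ) (p v a b : E) :
    ⟪fderiv ℝ K p v a, b⟫_ℝ = ⟪a, fderiv ℝ K p v b⟫_ℝ := by
  have happ (c : E) : HasFDerivAt (fun q => K q c) ((fderiv ℝ K p).flip c) p := by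
    simpa using (hK p).hasFDerivAt.clm_apply (hasFDerivAt_const c p)
  have h₁ := (happ a).inner ℝ (hasFDerivAt_const b p)
  have h₂ := (hasFDerivAt_const a p).inner ℝ (happ b)
  simp only [hsymm] at h₁
  simpa using congrArg (fun L => L v) (h₁.unique h₂)

/-- For an even kernel of symmetric operators, the pair energy is stationary along
`ẋ_α = u(x_α)`, `ṁ_α = -(Du(x_α))ᵀ m_α` with `u(p) = ∑ β, K (p - x_β) m_β`. -/
lemma hasDerivAt_pairEnergy_zero {K : E → E →L[ℝ] E} (hK : Differentiable ℝ K)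
    (heven : ∀ p, K (-p) = K p) (hsymm : ∀ p a b, ⟪K p a, b⟫_ℝ = ⟪a, K p b⟫_ℝ)
    {x m : ι → ℝ → E} {w : ι → E} {t : ℝ}
    (hx : ∀ α, HasDerivAt (x α) (∑ β, K (x α t - x β t) (m β t)) t)
    (hm : ∀ α, HasDerivAt (m α) (w α) t)
    (hw : ∀ α e, ⟪w α, e⟫_ℝ =
      -⟪m α t, fderiv ℝ (fun p => ∑ β, K (p - x β t) (m β t)) (x α t) e⟫_ℝ) :
    HasDerivAt (fun s => ∑ α, ∑ β, ⟪K (x α s - x β s) (m β s), m α s⟫_ℝ) 0 t := by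
  set v : ι → E := fun α => ∑ β, K (x α t - x β t) (m β t)
  have hu (α : ι) : HasFDerivAt (fun p => ∑ β, K (p - x β t) (m β t))
      (∑ β, (fderiv ℝ K (x α t - x β t)).flip (m β t)) (x α t) := by
    refine HasFDerivAt.fun_sum fun β _ => ?_
    have h := (hK (x α t - x β t)).hasFDerivAt.comp (x α t)
      ((hasFDerivAt_id (x α t)).sub_const (x β t))
    simpa using h.clm_apply (hasFDerivAt_const (m β t) (x α t))
  have hw' (α : ι) : ∑ β, ⟪K (x α t - x β t) (m β t), w α⟫_ℝ =
      -∑ β, ⟪fderiv ℝ K (x α t - x β t) (v α) (m β t), m α t⟫_ℝ := by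
    rw [← sum_inner, real_inner_comm, hw, (hu α).fderiv, real_inner_comm,
      sum_apply, sum_inner]
    rfl
  have hterm (α β : ι) : HasDerivAt (fun s => ⟪K (x α s - x β s) (m β s), m α s⟫_ℝ)
      (⟪K (x α t - x β t) (m β t), w α⟫_ℝ +
        ⟪fderiv ℝ K (x α t - x β t) (v α - v β) (m β t) + K (x α t - x β t) (w β), m α t⟫_ℝ) t :=
    HasDerivAt.inner ℝ
      (((hK _).hasFDerivAt.comp_hasDerivAt t ((hx α).sub (hx β))).clm_apply (hm β)) (hm α)
  have hsum := HasDerivAt.fun_sum (u := Finset.univ) fun α _ =>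
    HasDerivAt.fun_sum (u := Finset.univ) fun β _ => hterm α β
  refine hsum.congr_deriv ?_
  have hswapK : ∑ α, ∑ β, ⟪K (x α t - x β t) (w β), m α t⟫_ℝ =
      ∑ α, ∑ β, ⟪K (x α t - x β t) (m β t), w α⟫_ℝ := by
    rw [Finset.sum_comm]
    refine Finset.sum_congr rfl fun α _ => Finset.sum_congr rfl fun β _ => ?_
    rw [← neg_sub, heven, hsymm, real_inner_comm]
  have hswapD : ∑ α, ∑ β, ⟪fderiv ℝ K (x α t - x β t) (v β) (m β t), m α t⟫_ℝ =
      -∑ α, ∑ β, ⟪fderiv ℝ K (x α t - x β t) (v α) (m β t), m α t⟫_ℝ := by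
    rw [Finset.sum_comm, ← Finset.sum_neg_distrib]
    refine Finset.sum_congr rfl fun α _ => ?_
    rw [← Finset.sum_neg_distrib]
    refine Finset.sum_congr rfl fun β _ => ?_
    rw [← neg_sub, fderiv_neg_of_even hK heven, inner_fderiv_apply_comm hK hsymm (x α t - x β t),
      real_inner_comm]
    simp
  simp only [map_sub, sub_apply, inner_add_left, inner_sub_left,
    Finset.sum_add_distrib, Finset.sum_sub_distrib]
  rw [hswapD, hswapK]
  simp only [hw', Finset.sum_neg_distrib]
  ring

end PairInteraction

/-- The orthogonal projection of `ℝ³` onto the orthogonal complement of `k`. -/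
def realProjPerp (k : Fin 3 → ℤ) : E3 →L[ℝ] E3 := (ℝ ∙ kR k)ᗮ.starProjection

lemma realProjPerp_apply (k : Fin 3 → ℤ) (v : E3) :
    realProjPerp k v = v - (⟪kR k, v⟫_ℝ / ‖kR k‖ ^ 2) • kR k := by
  rw [realProjPerp, Submodule.starProjection_orthogonal_val, Submodule.starProjection_singleton]
  rfl

lemma norm_realProjPerp_le (k : Fin 3 → ℤ) : ‖realProjPerp k‖ ≤ 1 :=
  Submodule.starProjection_norm_le _

lemma inner_realProjPerp_comm (k : Fin 3 → ℤ) (a b : E3) :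
    ⟪realProjPerp k a, b⟫_ℝ = ⟪a, realProjPerp k b⟫_ℝ :=
  Submodule.inner_starProjection_left_eq_right _ a b

lemma inner_realProjPerp_realProjPerp (k : Fin 3 → ℤ) (a b : E3) :
    ⟪realProjPerp k a, realProjPerp k b⟫_ℝ = ⟪realProjPerp k a, b⟫_ℝ := by
  rw [← inner_realProjPerp_comm]
  congr 1
  exact congrArg (fun L => L a) (ℝ ∙ kR k)ᗮ.isIdempotentElem_starProjection

lemma inner_toC3 (a b : E3) : ⟪toC3 a, toC3 b⟫_ℂ = (⟪a, b⟫_ℝ : ℝ) := by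
  simp [toC3, PiLp.inner_apply]

lemma projPerp_sum_smul_toC3 {ι : Type*} [Fintype ι] (k : Fin 3 → ℤ) (c : ι → ℂ) (m : ι → E3) :
    projPerp k (∑ α, c α • toC3 (m α)) = ∑ α, c α • toC3 (realProjPerp k (m α)) := by
  have hk (v : E3) : toC3 (realProjPerp k v) =
      toC3 v - ((⟪kR k, v⟫_ℝ / ‖kR k‖ ^ 2 : ℝ) : ℂ) • kC k := by
    rw [realProjPerp_apply]
    ext i
    simp [toC3, kC, kR]
  have hkC : kC k = toC3 (kR k) := by
    ext i
    simp [kC, toC3, kR]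
  unfold projPerp
  split_ifs with h
  · have h0 : kC k = 0 := by
      ext i
      simp [kC, h]
    simp [hk, h0]
  · simp only [hk, smul_sub, Finset.sum_sub_distrib, inner_sum, inner_smul_right, smul_smul,
      ← Finset.sum_smul, Finset.sum_div, hkC, inner_toC3]
    congr 2
    refine Finset.sum_congr rfl fun α _ => ?_
    push_cast
    ring

lemma norm_sq_sum_exp_smul_toC3 {ι : Type*} [Fintype ι] (θ : ι → ℝ) (m : ι → E3) :
    ‖∑ α, Complex.exp (Complex.I * (θ α : ℂ)) • toC3 (m α)‖ ^ 2 =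
      ∑ α, ∑ β, Real.cos (θ α - θ β) * ⟪m β, m α⟫_ℝ := by
  rw [← inner_self_eq_norm_sq (𝕜 := ℂ)]
  simp only [sum_inner, inner_sum, inner_smul_left, inner_smul_right, inner_toC3, Finset.mul_sum,
    map_sum]
  refine Finset.sum_congr rfl fun α _ => Finset.sum_congr rfl fun β _ => ?_
  rw [← Complex.exp_conj, ← mul_assoc, ← Complex.exp_add]
  have : Complex.I * (θ α : ℂ) + (starRingEnd ℂ) (Complex.I * (θ β : ℂ)) =
      ((θ α - θ β : ℝ) : ℂ) * Complex.I := by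
    simp
    ring
  rw [this, RCLike.re_eq_complex_re, Complex.re_mul_ofReal, Complex.exp_ofReal_mul_I_re]

lemma summable_of_summable_weight {ρh : (Fin 3 → ℤ) → ℝ} (hnn : ∀ k, 0 ≤ ρh k)
    (hsum : Summable (fun k : Fin 3 → ℤ => (1 + ‖kR k‖ ^ 2) ^ 2 * ρh k)) : Summable ρh := by
  refine hsum.of_nonneg_of_le hnn fun k => le_mul_of_one_le_left (hnn k) ?_
  exact one_le_pow₀ (by nlinarith [sq_nonneg ‖kR k‖])

/-- The real operator-valued kernel `K(p) = (2π)⁻³ ∑_k ρ̂(k) cos⟨k, p⟩ Π_k`. -/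
def loopKernel (ρh : (Fin 3 → ℤ) → ℝ) (p : E3) : E3 →L[ℝ] E3 :=
  ((2 * π) ^ 3)⁻¹ • ∑' k : Fin 3 → ℤ, (ρh k * Real.cos ⟪kR k, p⟫_ℝ) • realProjPerp k

lemma summable_loopKernel {ρh : (Fin 3 → ℤ) → ℝ} (hnn : ∀ k, 0 ≤ ρh k) (hρ : Summable ρh)
    (p : E3) : Summable fun k => (ρh k * Real.cos ⟪kR k, p⟫_ℝ) • realProjPerp k := by
  refine Summable.of_norm_bounded hρ fun k => ?_
  rw [norm_smul, norm_mul, Real.norm_of_nonneg (hnn k)]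
  calc ρh k * ‖Real.cos ⟪kR k, p⟫_ℝ‖ * ‖realProjPerp k‖ ≤ ρh k * 1 * 1 := by
        gcongr
        · exact mul_nonneg (hnn k) zero_le_one
        · exact hnn k
        · exact Real.abs_cos_le_one _
        · exact norm_realProjPerp_le k
    _ = ρh k := by ring

lemma hasSum_loopKernel_apply {ρh : (Fin 3 → ℤ) → ℝ} (hnn : ∀ k, 0 ≤ ρh k) (hρ : Summable ρh)
    (p a : E3) : HasSum
      (fun k => ((2 * π) ^ 3)⁻¹ • (ρh k * Real.cos ⟪kR k, p⟫_ℝ) • realProjPerp k a)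
      (loopKernel ρh p a) :=
  ((summable_loopKernel hnn hρ p).hasSum.mapL (ContinuousLinearMap.apply ℝ E3 a)).const_smul _

lemma loopKernel_neg (ρh : (Fin 3 → ℤ) → ℝ) (p : E3) : loopKernel ρh (-p) = loopKernel ρh p := by
  simp [loopKernel]

lemma inner_loopKernel_comm {ρh : (Fin 3 → ℤ) → ℝ} (hnn : ∀ k, 0 ≤ ρh k) (hρ : Summable ρh)
    (p a b : E3) : ⟪loopKernel ρh p a, b⟫_ℝ = ⟪a, loopKernel ρh p b⟫_ℝ := by
  have h₁ := (hasSum_loopKernel_apply hnn hρ p a).mapL (innerSL ℝ b)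
  have h₂ := (hasSum_loopKernel_apply hnn hρ p b).mapL (innerSL ℝ a)
  rw [real_inner_comm]
  refine h₁.unique ?_
  simp only [innerSL_apply_apply, inner_smul_right] at h₂ ⊢
  convert h₂ using 4 with k
  rw [real_inner_comm _ b, inner_realProjPerp_comm]

lemma differentiable_loopKernel {ρh : (Fin 3 → ℤ) → ℝ} (hnn : ∀ k, 0 ≤ ρh k)
    (hsum : Summable (fun k : Fin 3 → ℤ => (1 + ‖kR k‖ ^ 2) ^ 2 * ρh k)) :
    Differentiable ℝ (loopKernel ρh) := by
  refine Differentiable.const_smul (R := ℝ) (differentiable_tsum hsum (f' := fun k p =>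
    (ρh k • -Real.sin ⟪kR k, p⟫_ℝ • innerSL ℝ (kR k)).smulRight (realProjPerp k))
    (fun k p => ?_) (fun k p => ?_)) _
  · exact ((innerSL ℝ (kR k)).hasFDerivAt.cos.const_mul (ρh k)).smul_const (realProjPerp k)
  · rw [ContinuousLinearMap.norm_smulRight_apply, norm_smul, norm_smul, norm_neg,
      Real.norm_of_nonneg (hnn k), innerSL_apply_norm]
    calc ρh k * (‖Real.sin ⟪kR k, p⟫_ℝ‖ * ‖kR k‖) * ‖realProjPerp k‖
        ≤ ρh k * (1 * ‖kR k‖) * 1 := by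
          gcongr
          · exact mul_nonneg (hnn k) (by positivity)
          · exact hnn k
          · exact Real.abs_sin_le_one _
          · exact norm_realProjPerp_le k
      _ = ‖kR k‖ * ρh k := by ring
      _ ≤ (1 + ‖kR k‖ ^ 2) ^ 2 * ρh k := by
          gcongr
          · exact hnn k
          · nlinarith [sq_nonneg (‖kR k‖ - 1), sq_nonneg ‖kR k‖, sq_nonneg (‖kR k‖ ^ 2)]

lemma loopVel_eq_sum_loopKernel (N : ℕ) {ρh : (Fin 3 → ℤ) → ℝ} (hnn : ∀ k, 0 ≤ ρh k)
    (hρ : Summable ρh) (x m : Fin N → E3) (p : E3) :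
    loopVel N ρh x m p = ∑ β, loopKernel ρh (p - x β) (m β) := by
  have hsummable : Summable fun k : Fin 3 → ℤ => (ρh k : ℂ) • projPerp k (∑ α,
      Complex.exp (-Complex.I * ((inner ℝ (kR k) (p - x α) : ℝ) : ℂ)) • toC3 (m α)) := by
    refine Summable.of_norm_bounded (hρ.mul_right (∑ α, ‖m α‖)) fun k => ?_
    rw [projPerp_sum_smul_toC3, norm_smul, Complex.norm_real, Real.norm_of_nonneg (hnn k)]
    refine mul_le_mul_of_nonneg_left (norm_sum_le_of_le _ fun α _ => ?_) (hnn k)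
    have hexp : -Complex.I * ((inner ℝ (kR k) (p - x α) : ℝ) : ℂ) =
        ((-inner ℝ (kR k) (p - x α) : ℝ) : ℂ) * Complex.I := by
      push_cast
      ring
    have hnorm (v : E3) : ‖toC3 v‖ = ‖v‖ := by
      simp [EuclideanSpace.norm_eq, toC3]
    rw [norm_smul, hexp, Complex.norm_exp_ofReal_mul_I, one_mul, hnorm]
    exact (ContinuousLinearMap.le_of_opNorm_le _ (norm_realProjPerp_le k) _).trans_eq (one_mul _)
  ext i
  let L : C3 →L[ℝ] ℝ :=
    Complex.reCLM.comp ((EuclideanSpace.proj i : C3 →L[ℂ] ℂ).restrictScalars ℝ)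
  have h₁ := (hsummable.hasSum.const_smul (((2 * π : ℝ) ^ 3)⁻¹)).mapL L
  have h₂ := (hasSum_sum (s := Finset.univ) fun β _ =>
    hasSum_loopKernel_apply hnn hρ (p - x β) (m β)).mapL (EuclideanSpace.proj i : E3 →L[ℝ] ℝ)
  have hre (θ : ℝ) : (Complex.exp (-(Complex.I * (θ : ℂ)))).re = Real.cos θ := by
    simp [Complex.exp_re]
  have hterms : (fun k => L (((2 * π : ℝ) ^ 3)⁻¹ • (ρh k : ℂ) • projPerp k (∑ α,
      Complex.exp (-Complex.I * ((inner ℝ (kR k) (p - x α) : ℝ) : ℂ)) • toC3 (m α)))) =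
      fun k => (EuclideanSpace.proj i : E3 →L[ℝ] ℝ) (∑ β, ((2 * π) ^ 3)⁻¹ •
        (ρh k * Real.cos ⟪kR k, p - x β⟫_ℝ) • realProjPerp k (m β)) := by
    funext k
    rw [projPerp_sum_smul_toC3]
    simp [L, toC3, hre, Finset.mul_sum, mul_assoc]
  rw [hterms] at h₁
  exact h₁.unique h₂

lemma loopEnergy_eq_sum_loopKernel (N : ℕ) {ρh : (Fin 3 → ℤ) → ℝ} (hnn : ∀ k, 0 ≤ ρh k)
    (hρ : Summable ρh) (x m : Fin N → E3) :
    loopEnergy N ρh x m =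
      1 / 2 * ∑ α, ∑ β, ⟪loopKernel ρh (x α - x β) (m β), m α⟫_ℝ := by
  have h : HasSum (fun k => ∑ α, ∑ β, ⟪m α, ((2 * π) ^ 3)⁻¹ •
      (ρh k * Real.cos ⟪kR k, x α - x β⟫_ℝ) • realProjPerp k (m β)⟫_ℝ)
      (∑ α, ∑ β, ⟪m α, loopKernel ρh (x α - x β) (m β)⟫_ℝ) :=
    hasSum_sum fun α _ => hasSum_sum fun β _ =>
      (hasSum_loopKernel_apply hnn hρ (x α - x β) (m β)).mapL (innerSL ℝ (m α))
  simp only [real_inner_comm _ (m _)] at h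
  rw [← h.tsum_eq, loopEnergy, ← tsum_mul_left, ← tsum_mul_left]
  refine tsum_congr fun k => ?_
  rw [projPerp_sum_smul_toC3, norm_sq_sum_exp_smul_toC3]
  simp only [Finset.mul_sum, inner_realProjPerp_realProjPerp, inner_smul_left, inner_sub_right]
  refine Finset.sum_congr rfl fun α _ => Finset.sum_congr rfl fun β _ => ?_
  simp
  ring

/-- Conservation of the energy along continuously differentiable solutions of the
periodic vortex loop system on `[0,T]`. -/
theorem loop_energy_conservation (N : ℕ) (hN : 0 < N) (ρh : (Fin 3 → ℤ) → ℝ)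
    (hnn : ∀ k, 0 ≤ ρh k) (hsym : ∀ k, ρh (-k) = ρh k)
    (hsum : Summable (fun k : Fin 3 → ℤ => (1 + ‖kR k‖ ^ 2) ^ 2 * ρh k))
    (T : ℝ) (hT : 0 < T) (x m : Fin N → ℝ → E3)
    (hx : ∀ α, ContDiff ℝ 1 (x α)) (hm : ∀ α, ContDiff ℝ 1 (m α))
    (hsol : IsLoopSystemSolution N ρh x m (Icc 0 T)) :
    ∀ t ∈ Icc (0:ℝ) T,
      loopEnergy N ρh (fun β => x β t) (fun β => m β t) =
        loopEnergy N ρh (fun β => x β 0) (fun β => m β 0) := by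
  have hρ := summable_of_summable_weight hnn hsum
  have hvel (t : ℝ) : loopVel N ρh (fun β => x β t) (fun β => m β t) =
      fun p => ∑ β, loopKernel ρh (p - x β t) (m β t) :=
    funext (loopVel_eq_sum_loopKernel N hnn hρ _ _)
  have hderiv : ∀ t ∈ Icc (0:ℝ) T, HasDerivAt
      (fun s => loopEnergy N ρh (fun β => x β s) (fun β => m β s)) 0 t := by
    intro t ht
    have hm' (α : Fin N) : HasDerivAt (m α) (deriv (m α) t) t :=
      ((hm α).differentiable one_ne_zero t).hasDerivAt
    simp only [loopEnergy_eq_sum_loopKernel N hnn hρ]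
    rw [← mul_zero (1 / 2 : ℝ)]
    refine (hasDerivAt_pairEnergy_zero (differentiable_loopKernel hnn hsum) (loopKernel_neg ρh)
      (inner_loopKernel_comm hnn hρ) (fun α => ?_) hm' fun α e => ?_).const_mul _
    · simpa only [hvel] using (hsol t ht α).1
    · have hcoord (i : Fin 3) := ((EuclideanSpace.proj i : E3 →L[ℝ] ℝ).hasFDerivAt.comp_hasDerivAt t
        (hm' α)).unique ((hsol t ht α).2 i)
      rw [← hvel]
      set D := fderiv ℝ (loopVel N ρh (fun β => x β t) (fun β => m β t)) (x α t)
      have he : e = ∑ i, e i • EuclideanSpace.single i (1 : ℝ) := by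
        ext j
        simp [Finset.sum_apply, Pi.single_apply]
      simp only [PiLp.proj_apply] at hcoord
      conv_rhs => rw [he, map_sum, inner_sum, ← Finset.sum_neg_distrib]
      rw [PiLp.inner_apply]
      refine Finset.sum_congr rfl fun i _ => ?_
      rw [hcoord, map_smul, inner_smul_right, PiLp.inner_apply]
      simp [mul_comm]
  exact constant_of_has_deriv_right_zero
    (fun t ht => (hderiv t ht).continuousAt.continuousWithinAt)
    fun t ht => (hderiv t (Ico_subset_Icc_self ht)).hasDerivWithinAt
end
end

section
/- Let φ : ℝ³ → ℝ be differentiable and even, let N ≥ 1, and let x_α, ξ_α ∈ ℝ³ for α = 1,…,N. With u(x) = ∑_{α=1}^N ∇φ(x − x_α) ∧ ξ_α, the following cancellation identity holds: ∑_{α,β=1}^N ⟨u(x_β), ∇φ(x_α − x_β)⟩ ⟨ξ_α, ξ_β⟩ − ∑_{α,β=1}^N ⟨ξ_α, u(x_β)⟩ ⟨ξ_β, ∇φ(x_α − x_β)⟩ = 0. -/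
noncomputable section
open MeasureTheory Real Set

/-- The Fourier transform `∫_{ℝ³} e^{i⟨k,x⟩} f(x) dx` of `f : ℝ³ → ℝ`, as a complex number. -/
def fourierInt (f : E3 → ℝ) (k : E3) : ℂ :=
  ∫ x : E3, Complex.exp (Complex.I * ((inner ℝ k x : ℝ) : ℂ)) * (f x : ℂ)

/-- Hypothesis A: `φ` is even, continuous, integrable, its Fourier transform is the real
nonnegative function `φhat`, and `φhat` satisfies the moment condition (A.4). -/
structure HypA (φ : E3 → ℝ) (φhat : E3 → ℝ) : Prop where
  even : ∀ x, φ (-x) = φ x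
  cont : Continuous φ
  integrable : Integrable φ
  fourier_eq : ∀ k, (φhat k : ℂ) = fourierInt φ k
  nonneg : ∀ k, 0 ≤ φhat k
  moment : Integrable (fun k : E3 => (1 + ‖k‖ ^ 2) ^ 2 * φhat k)

/-- The velocity field `u(x) = ∑_α ∇φ(x − x_α) ∧ ξ_α` of a discrete vorticity
configuration `(x_α, ξ_α)`. -/
def discVel (φ : E3 → ℝ) {N : ℕ} (x ξ : Fin N → E3) (p : E3) : E3 :=
  ∑ α, cross3 (gradient φ (p - x α)) (ξ α)

/-- The energy `H = (1/2) ∑_{α,β} φ(x_α − x_β) ⟨ξ_α, ξ_β⟩`. -/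
def discEnergy (φ : E3 → ℝ) {N : ℕ} (x ξ : Fin N → E3) : ℝ :=
  (1 / 2) * ∑ α, ∑ β, φ (x α - x β) * (inner ℝ (ξ α) (ξ β) : ℝ)

/-- The length `L = ∑_α |ξ_α|` of the configuration. -/
def discLength {N : ℕ} (ξ : Fin N → E3) : ℝ := ∑ α, ‖ξ α‖

/-- The quadratic variation `A = ∑_α |ξ_α|²` of the configuration. -/
def discQuad {N : ℕ} (ξ : Fin N → E3) : ℝ := ∑ α, ‖ξ α‖ ^ 2

/-- The field `Ψ(x) = ∑_α φ(x − x_α) ξ_α`. -/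
def discPsi (φ : E3 → ℝ) {N : ℕ} (x ξ : Fin N → E3) (p : E3) : E3 :=
  ∑ α, φ (p - x α) • ξ α

/-- The curl of a vector field on `ℝ³`, computed with `fderiv`. -/
def curl3 (F : E3 → E3) (p : E3) : E3 :=
  !₂[fderiv ℝ F p (EuclideanSpace.single 1 1) 2 - fderiv ℝ F p (EuclideanSpace.single 2 1) 1,
    fderiv ℝ F p (EuclideanSpace.single 2 1) 0 - fderiv ℝ F p (EuclideanSpace.single 0 1) 2,
    fderiv ℝ F p (EuclideanSpace.single 0 1) 1 - fderiv ℝ F p (EuclideanSpace.single 1 1) 0]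

/-- The function `Φ(x) = ⟨Ψ(x), curl Ψ(x)⟩`. -/
def discPhi (φ : E3 → ℝ) {N : ℕ} (x ξ : Fin N → E3) (p : E3) : ℝ :=
  inner ℝ (discPsi φ x ξ p) (curl3 (discPsi φ x ξ) p)

/-- The inner product of two cross products (Binet–Cauchy identity). -/
theorem inner_cross3_cross3 (a b c d : E3) :
    inner ℝ (cross3 a b) (cross3 c d) =
      inner ℝ a c * inner ℝ b d - inner ℝ a d * inner ℝ b c := by
  simp [cross3, cross_apply, PiLp.inner_apply, Fin.sum_univ_three]
  ring

theorem inner_cross3_self (a b : E3) : inner ℝ a (cross3 a b) = 0 := by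
  simp [cross3, cross_apply, PiLp.inner_apply, Fin.sum_univ_three]
  ring

theorem cross3_neg_left (a b : E3) : cross3 (-a) b = -cross3 a b := by
  simp only [cross3, WithLp.ofLp_neg, map_neg, LinearMap.neg_apply, WithLp.toLp_neg]

/-- The gradient of an even function is odd. -/
theorem gradient_neg_of_even {φ : E3 → ℝ} (heven : ∀ x, φ (-x) = φ x) (p : E3) :
    gradient φ (-p) = -gradient φ p := by
  have h : fderiv ℝ φ p = -fderiv ℝ φ (-p) := by
    simpa [heven] using fderiv_comp_smul (𝕜 := ℝ) (f := φ) (-1) (x := p)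
  simp [gradient, h]

theorem sum_cross3_gradient_eq_neg_discVel {φ : E3 → ℝ} (heven : ∀ x, φ (-x) = φ x) {N : ℕ}
    (x ξ : Fin N → E3) (p : E3) :
    ∑ α, cross3 (gradient φ (x α - p)) (ξ α) = -discVel φ x ξ p := by
  simp only [discVel, ← Finset.sum_neg_distrib, ← cross3_neg_left, ← gradient_neg_of_even heven,
    neg_sub]

/-- The key cancellation identity in the computation of the energy rate for
discrete vorticity models. -/
theorem discrete_cancellation (φ : E3 → ℝ) (hdiff : Differentiable ℝ φ)
    (heven : ∀ x, φ (-x) = φ x) (N : ℕ) (hN : 0 < N) (x ξ : Fin N → E3) :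
    (∑ α, ∑ β,
        (inner ℝ (discVel φ x ξ (x β)) (gradient φ (x α - x β)) : ℝ) *
          (inner ℝ (ξ α) (ξ β) : ℝ)) -
      (∑ α, ∑ β,
        (inner ℝ (ξ α) (discVel φ x ξ (x β)) : ℝ) *
          (inner ℝ (ξ β) (gradient φ (x α - x β)) : ℝ)) = 0 := by
  rw [Finset.sum_comm, Finset.sum_comm (f := fun α β =>
    inner ℝ (ξ α) (discVel φ x ξ (x β)) * inner ℝ (ξ β) (gradient φ (x α - x β))),
    ← Finset.sum_sub_distrib]
  refine Finset.sum_eq_zero fun β _ => ?_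
  rw [← Finset.sum_sub_distrib]
  calc
    _ = ∑ α, inner ℝ (cross3 (gradient φ (x α - x β)) (ξ α))
          (cross3 (discVel φ x ξ (x β)) (ξ β)) := by
      refine Finset.sum_congr rfl fun α _ => ?_
      rw [inner_cross3_cross3, real_inner_comm (discVel φ x ξ (x β)) (gradient φ (x α - x β)),
        real_inner_comm (ξ β) (gradient φ (x α - x β))]
      ring
    _ = 0 := by
      rw [← sum_inner, sum_cross3_gradient_eq_neg_discVel heven, inner_neg_left,
        inner_cross3_self, neg_zero]
end
end
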